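/- For every θ ≥ 2, α > 0, c_0 > 0, constants c_1, c_2 > 0 and every choice of constants in the Harnack assumptions there exist c, C > 0 such that: for every Markov kernel (Γ,K,π) satisfying the Harnack assumptions with parameter θ and those constants, with diameter D ≥ 2, and satisfying the Ahlfors regularity condition c_1·r^α ≤ |V|·V(x,r) ≤ c_2·r^α for all x ∈ V and all real 1 ≤ r ≤ D, the following holds for all a, b ∈ V with d(a,b) ≥ c_0·D: if α > θ then c·D^α ≤ H(a,b) ≤ C·D^α; if α = θ then c·D^θ·log D ≤ H(a,b) ≤ C·D^θ·log D; and if 0 < α < θ then c·D^θ ≤ H(a,b) ≤ C·D^θ. -/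

import Mathlib

open Finset
open scoped Classical

variable {V : Type*} [Fintype V] [DecidableEq V]

/-- `matpow K n` is the `n`-th matrix power of the kernel `K`. -/
noncomputable def matpow (K : V → V → ℝ) : ℕ → V → V → ℝ
  | 0 => fun x y => if x = y then (1 : ℝ) else 0
  | n + 1 => fun x y => ∑ z, K x z * matpow K n z y

/-- `(Γ, K, π)` is a Markov kernel: `G` is a connected (simple) graph on the finite vertex
set `V`, `K` is a stochastic kernel, irreducible, reversible with respect to the probability
measure `pi`, positive on edges and vanishing off edges (apart from the diagonal). -/
def IsMarkovKernel (G : SimpleGraph V) (K : V → V → ℝ) (pi : V → ℝ) : Prop :=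
  G.Connected ∧
  (∀ x y, 0 ≤ K x y) ∧ (∀ x, ∑ y, K x y = 1) ∧
  (∀ x, 0 < pi x) ∧ (∑ x, pi x = 1) ∧
  (∀ x y, pi x * K x y = pi y * K y x) ∧
  (∀ x y, G.Adj x y → 0 < K x y) ∧
  (∀ x y, x ≠ y → ¬ G.Adj x y → K x y = 0) ∧
  (∀ x y, ∃ n, 0 < matpow K n x y)

/-- Aperiodicity of an irreducible finite kernel, via primitivity. -/
def Aperiodic (K : V → V → ℝ) : Prop :=
  ∃ N : ℕ, ∀ n ≥ N, ∀ x y, 0 < matpow K n x y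

/-- `K` is lazy if `K(x,x) ≥ 1/2` for all `x`. -/
def Lazy (K : V → V → ℝ) : Prop := ∀ x, (1 : ℝ) / 2 ≤ K x x

/-- The closed ball `B(x,r)` for the graph distance. -/
noncomputable def gball (G : SimpleGraph V) (x : V) (r : ℝ) : Finset V :=
  univ.filter fun y => (G.dist x y : ℝ) ≤ r

/-- The volume `V(x,r) = π(B(x,r))`. -/
noncomputable def vol (G : SimpleGraph V) (pi : V → ℝ) (x : V) (r : ℝ) : ℝ :=
  ∑ y ∈ gball G x r, pi y

/-- The diameter of the graph `G`. -/
noncomputable def gdiam (G : SimpleGraph V) : ℕ :=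
  univ.sup fun x => univ.sup fun y => G.dist x y

/-- The normalized kernel `k^n(x,y) = K^n(x,y)/π(y)`. -/
noncomputable def knorm (K : V → V → ℝ) (pi : V → ℝ) (n : ℕ) (x y : V) : ℝ :=
  matpow K n x y / pi y

/-- The normalized Green function `𝒢(x,y) = ∑_{n≥0} (k^n(x,y) - 1)`. -/
noncomputable def green (K : V → V → ℝ) (pi : V → ℝ) (x y : V) : ℝ :=
  ∑' n : ℕ, (knorm K pi n x y - 1)

/-- `avoid K y n x = P_x(X_0 ≠ y, …, X_n ≠ y) = P_x(τ_y > n)`. -/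
noncomputable def avoid (K : V → V → ℝ) (y : V) : ℕ → V → ℝ
  | 0 => fun x => if x = y then 0 else 1
  | n + 1 => fun x => if x = y then 0 else ∑ z, K x z * avoid K y n z

/-- The expected hitting time `H(x,y) = E_x[τ_y] = ∑_{n≥0} P_x(τ_y > n)`. -/
noncomputable def hit (K : V → V → ℝ) (x y : V) : ℝ := ∑' n : ℕ, avoid K y n x

/-- `P_x(d(x, X_s) > R)` for the chain driven by `K` started at `x`. -/
noncomputable def probGt (G : SimpleGraph V) (K : V → V → ℝ) (x : V) (s : ℕ) (R : ℝ) : ℝ :=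
  ∑ y ∈ univ.filter (fun y => R < (G.dist x y : ℝ)), matpow K s x y

/-- The probability that the chain driven by `K`, started at `x`, produces a trajectory
`(X_0, …, X_t)` belonging to the event `A`. -/
noncomputable def pathProb (K : V → V → ℝ) (x : V) (t : ℕ)
    (A : (Fin (t + 1) → V) → Prop) : ℝ :=
  ∑ p ∈ univ.filter (fun p : Fin (t + 1) → V => p 0 = x ∧ A p),
    ∏ i : Fin t, K (p i.castSucc) (p i.succ)

/-- Condition (E): ellipticity with constant `p0`. -/
def CondE (G : SimpleGraph V) (K : V → V → ℝ) (p0 : ℝ) : Prop :=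
  ∀ x y, G.Adj x y → p0 ≤ K x y

/-- Condition (VD): volume doubling with constant `CD`. -/
def CondVD (G : SimpleGraph V) (pi : V → ℝ) (CD : ℝ) : Prop :=
  ∀ x : V, ∀ r : ℝ, 0 < r → vol G pi x (2 * r) ≤ CD * vol G pi x r

/-- The `π`-average of `f` over the ball `B(x,r)`. -/
noncomputable def ballAvg (G : SimpleGraph V) (pi : V → ℝ) (x : V) (r : ℝ) (f : V → ℝ) : ℝ :=
  (vol G pi x r)⁻¹ * ∑ z ∈ gball G x r, f z * pi z

/-- Condition (PI(θ)): Poincaré inequality with constant `CP`. -/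
def CondPI (G : SimpleGraph V) (K : V → V → ℝ) (pi : V → ℝ) (θ CP : ℝ) : Prop :=
  ∀ x : V, ∀ r : ℝ, 0 < r → ∀ f : V → ℝ,
    (∑ z ∈ gball G x r, |f z - ballAvg G pi x r f| ^ 2 * pi z) ≤
      CP * r ^ θ * ∑ ξ ∈ gball G x r, ∑ ζ ∈ gball G x r,
        if G.Adj ξ ζ then |f ξ - f ζ| ^ 2 * K ξ ζ * pi ξ else 0

/-- Condition (CS(θ)): existence of cut-off functions. -/
def CondCS (G : SimpleGraph V) (K : V → V → ℝ) (pi : V → ℝ) (θ C1 C2 ε : ℝ) : Prop :=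
  ∀ x : V, ∀ r : ℝ, 0 < r → ∃ σ : V → ℝ,
    (∀ y ∈ gball G x (r / 2), 1 ≤ σ y) ∧
    (∀ y, y ∉ gball G x r → σ y = 0) ∧
    (∀ z y, |σ z - σ y| ≤ C1 * ((G.dist z y : ℝ) / r) ^ ε) ∧
    (∀ s : ℝ, 0 < s → s ≤ r → ∀ f : V → ℝ,
      (∑ z ∈ gball G x s, |f z| ^ 2 *
          ∑ y, (if G.Adj z y then |σ z - σ y| ^ 2 * K z y * pi z else 0)) ≤
        C2 * (s / r) ^ (2 * ε) *
          ((∑ z ∈ gball G x (2 * s), ∑ y ∈ gball G x (2 * s),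
              if G.Adj z y then |f z - f y| ^ 2 * K z y * pi z else 0) +
            s ^ (-θ) * ∑ z ∈ gball G x (2 * s), |f z| ^ 2 * pi z))

/-- The Harnack assumptions (E), (VD), (PI(θ)), (CS(θ)) with the given constants. -/
def Harnack (G : SimpleGraph V) (K : V → V → ℝ) (pi : V → ℝ)
    (θ p0 CD CP Ccs1 Ccs2 ε : ℝ) : Prop :=
  0 < p0 ∧ 0 < CD ∧ 0 < CP ∧ 0 < Ccs1 ∧ 0 < Ccs2 ∧ 0 < ε ∧
  CondE G K p0 ∧ CondVD G pi CD ∧ CondPI G K pi θ CP ∧ CondCS G K pi θ Ccs1 Ccs2 ε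

set_option linter.unusedSectionVars false

/-- The (doubled) Dirichlet form. -/
noncomputable def edf (K : V → V → ℝ) (pi : V → ℝ) (f g : V → ℝ) : ℝ :=
  ∑ x, ∑ y, (f x - f y) * (g x - g y) * (K x y * pi x)

/-- The local energy on a ball. -/
noncomputable def eball (G : SimpleGraph V) (K : V → V → ℝ) (pi : V → ℝ) (x : V) (r : ℝ)
    (f : V → ℝ) : ℝ :=
  ∑ ξ ∈ gball G x r, ∑ ζ ∈ gball G x r, (f ξ - f ζ) ^ 2 * (K ξ ζ * pi ξ)

/-- The mean value with respect to the stationary measure. -/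
noncomputable def mean (pi : V → ℝ) (f : V → ℝ) : ℝ := ∑ x, pi x * f x

/-- The collection of hypotheses used throughout. -/
structure HS (G : SimpleGraph V) (K : V → V → ℝ) (pi : V → ℝ) (θ α c1 c2 CD CP N D : ℝ) :
    Prop where
  conn : G.Connected
  K0 : ∀ x y, 0 ≤ K x y
  K1 : ∀ x, ∑ y, K x y = 1
  pi0 : ∀ x, 0 < pi x
  pi1 : ∑ x, pi x = 1
  rev : ∀ x y, pi x * K x y = pi y * K y x
  Koff : ∀ x y, x ≠ y → ¬ G.Adj x y → K x y = 0
  ell : ∃ p0 : ℝ, 0 < p0 ∧ CondE G K p0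
  VD : CondVD G pi CD
  PI : CondPI G K pi θ CP
  c1pos : 0 < c1
  c2pos : 0 < c2
  CDpos : 0 < CD
  CPpos : 0 < CP
  Npos : 0 < N
  D2 : 2 ≤ D
  distD : ∀ x y, (G.dist x y : ℝ) ≤ D
  vlow : ∀ x r, 1 ≤ r → r ≤ 2 * D → c1 * r ^ α ≤ N * vol G pi x r
  vup : ∀ x r, 1 ≤ r → N * vol G pi x r ≤ c2 * r ^ α

section basics

variable {G : SimpleGraph V} {K : V → V → ℝ} {pi : V → ℝ} {θ α c1 c2 CD CP N D : ℝ}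

lemma edf_green (H : HS G K pi θ α c1 c2 CD CP N D) (f g : V → ℝ) :
    edf K pi f g = 2 * ∑ x, pi x * (f x - ∑ y, K x y * f y) * g x := by
  have h1 : ∑ x, pi x * (f x - ∑ y, K x y * f y) * g x
      = ∑ x, ∑ y, (f x - f y) * g x * (K x y * pi x) := by
    refine Finset.sum_congr rfl fun x _ => ?_
    have : f x = ∑ y, K x y * f x := by rw [← Finset.sum_mul, H.K1, one_mul]
    conv_lhs => rw [this]
    rw [← Finset.sum_sub_distrib, Finset.mul_sum, Finset.sum_mul]
    refine Finset.sum_congr rfl fun y _ => ?_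
    ring
  have h2 : ∑ x, ∑ y, (f x - f y) * g x * (K x y * pi x)
      = ∑ x, ∑ y, -((f x - f y) * g y * (K x y * pi x)) := by
    rw [Finset.sum_comm]
    refine Finset.sum_congr rfl fun x _ => Finset.sum_congr rfl fun y _ => ?_
    have := H.rev x y
    rw [mul_comm (K y x), ← this]; ring
  rw [two_mul]
  conv_rhs => rw [h1]; arg 2; rw [h2]
  rw [← Finset.sum_add_distrib]
  unfold edf
  refine Finset.sum_congr rfl fun x _ => ?_
  rw [← Finset.sum_add_distrib]
  refine Finset.sum_congr rfl fun y _ => ?_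
  ring

lemma w_nonneg (H : HS G K pi θ α c1 c2 CD CP N D) (x y : V) : 0 ≤ K x y * pi x :=
  mul_nonneg (H.K0 x y) (H.pi0 x).le

lemma edf_nonneg (H : HS G K pi θ α c1 c2 CD CP N D) (f : V → ℝ) : 0 ≤ edf K pi f f :=
  Finset.sum_nonneg fun x _ => Finset.sum_nonneg fun y _ =>
    mul_nonneg (mul_self_nonneg _) (w_nonneg H x y)

lemma edf_cs (H : HS G K pi θ α c1 c2 CD CP N D) (f g : V → ℝ) :
    (edf K pi f g) ^ 2 ≤ edf K pi f f * edf K pi g g := by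
  unfold edf
  simp only [← Finset.sum_product']
  refine Finset.sum_sq_le_sum_mul_sum_of_sq_le_mul _ ?_ ?_ ?_
  · intro i _; exact mul_nonneg (mul_self_nonneg _) (w_nonneg H _ _)
  · intro i _; exact mul_nonneg (mul_self_nonneg _) (w_nonneg H _ _)
  · intro i _; exact le_of_eq (by ring)

lemma edf_mono_contr (H : HS G K pi θ α c1 c2 CD CP N D) (f u : V → ℝ)
    (hu : ∀ x y, (u x - u y) ^ 2 ≤ (f x - f y) * (u x - u y)) :
    edf K pi u u ≤ edf K pi f u := by
  unfold edf
  refine Finset.sum_le_sum fun x _ => Finset.sum_le_sum fun y _ => ?_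
  refine mul_le_mul_of_nonneg_right ?_ (w_nonneg H x y)
  have := hu x y
  nlinarith

lemma eball_le_edf (H : HS G K pi θ α c1 c2 CD CP N D) (x : V) (r : ℝ) (f : V → ℝ) :
    eball G K pi x r f ≤ edf K pi f f := by
  unfold eball edf
  have hh : ∀ x y, 0 ≤ (f x - f y) ^ 2 * (K x y * pi x) := fun x y =>
    mul_nonneg (sq_nonneg _) (w_nonneg H x y)
  calc _ ≤ ∑ ξ ∈ gball G x r, ∑ ζ, (f ξ - f ζ) ^ 2 * (K ξ ζ * pi ξ) :=
        Finset.sum_le_sum fun ξ _ => Finset.sum_le_sum_of_subset_of_nonneg (subset_univ _)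
          (fun _ _ _ => hh _ _)
    _ ≤ ∑ ξ, ∑ ζ, (f ξ - f ζ) ^ 2 * (K ξ ζ * pi ξ) :=
        Finset.sum_le_sum_of_subset_of_nonneg (subset_univ _)
          (fun _ _ _ => Finset.sum_nonneg fun _ _ => hh _ _)
    _ = _ := by
        refine Finset.sum_congr rfl fun x _ => Finset.sum_congr rfl fun y _ => ?_
        ring

lemma pi_ball (H : HS G K pi θ α c1 c2 CD CP N D) (x : V) (r : ℝ) (hr : 0 < r) (f : V → ℝ) :
    ∑ z ∈ gball G x r, (f z - ballAvg G pi x r f) ^ 2 * pi z ≤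
      CP * r ^ θ * eball G K pi x r f := by
  have h := H.PI x r hr f
  simp only [sq_abs] at h
  refine h.trans (le_of_eq ?_)
  unfold eball
  congr 1
  refine Finset.sum_congr rfl fun ξ _ => Finset.sum_congr rfl fun ζ _ => ?_
  by_cases ha : G.Adj ξ ζ
  · simp [ha, mul_assoc]
  · by_cases he : ξ = ζ
    · simp [he]
    · simp [ha, H.Koff ξ ζ he ha]

lemma mem_gball {x y : V} {r : ℝ} : y ∈ gball G x r ↔ (G.dist x y : ℝ) ≤ r := by
  simp [gball]

lemma self_mem_gball {x : V} {r : ℝ} (hr : 0 ≤ r) : x ∈ gball G x r := by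
  simp [mem_gball, hr]

lemma vol_pos (H : HS G K pi θ α c1 c2 CD CP N D) (x : V) {r : ℝ} (hr : 0 ≤ r) :
    0 < vol G pi x r :=
  Finset.sum_pos (fun z _ => H.pi0 z) ⟨x, self_mem_gball hr⟩

lemma vol_mono (H : HS G K pi θ α c1 c2 CD CP N D) (x : V) {r s : ℝ} (hr : r ≤ s) :
    vol G pi x r ≤ vol G pi x s := by
  refine Finset.sum_le_sum_of_subset_of_nonneg ?_ (fun z _ _ => (H.pi0 z).le)
  intro z; simp only [mem_gball]; intro h; linarith

lemma gball_univ (H : HS G K pi θ α c1 c2 CD CP N D) (x : V) {r : ℝ} (hr : D ≤ r) :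
    gball G x r = univ := by
  ext z; simp only [mem_gball, mem_univ, iff_true]; exact (H.distD x z).trans hr

lemma vol_univ (H : HS G K pi θ α c1 c2 CD CP N D) (x : V) {r : ℝ} (hr : D ≤ r) :
    vol G pi x r = 1 := by
  unfold vol; rw [gball_univ H x hr, H.pi1]

lemma gball_half (H : HS G K pi θ α c1 c2 CD CP N D) (x : V) :
    gball G x (1 / 2) = {x} := by
  ext z; simp only [mem_gball, mem_singleton]
  constructor
  · intro h
    have : G.dist x z = 0 := by
      by_contra h0
      have : (1 : ℝ) ≤ G.dist x z := by exact_mod_cast Nat.one_le_iff_ne_zero.mpr h0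
      linarith
    exact ((H.conn.dist_eq_zero_iff).1 this).symm
  · rintro rfl; simp

lemma one_le_CD (H : HS G K pi θ α c1 c2 CD CP N D) (x : V) : 1 ≤ CD := by
  have h := H.VD x 1 one_pos
  have h2 := vol_mono H x (show (1 : ℝ) ≤ 2 * 1 by norm_num)
  have h3 := vol_pos H x (zero_le_one (α := ℝ))
  by_contra hc
  push Not at hc
  nlinarith

lemma pi_le_one (H : HS G K pi θ α c1 c2 CD CP N D) (x : V) : pi x ≤ 1 := by
  rw [← H.pi1]; exact Finset.single_le_sum (fun z _ => (H.pi0 z).le) (mem_univ x)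

lemma N_bounds (H : HS G K pi θ α c1 c2 CD CP N D) (x : V) :
    c1 * D ^ α ≤ N ∧ N ≤ c2 * D ^ α := by
  have hD := H.D2
  have h1 := H.vlow x D (by linarith) (by linarith)
  have h2 := H.vup x D (by linarith)
  rw [vol_univ H x le_rfl, mul_one] at h1 h2
  exact ⟨h1, h2⟩

end basics

section hitting

variable {G : SimpleGraph V} {K : V → V → ℝ} {pi : V → ℝ} {θ α c1 c2 CD CP N D : ℝ}

lemma avoid_nonneg (H : HS G K pi θ α c1 c2 CD CP N D) (b : V) (n : ℕ) (x : V) :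
    0 ≤ avoid K b n x := by
  induction n generalizing x with
  | zero => simp only [avoid]; split_ifs <;> norm_num
  | succ n ih =>
    simp only [avoid]; split_ifs
    · exact le_rfl
    · exact Finset.sum_nonneg fun z _ => mul_nonneg (H.K0 _ _) (ih z)

/-- A supersolution bounds the partial sums of survival probabilities. -/
lemma exists_super (H : HS G K pi θ α c1 c2 CD CP N D) (b : V) :
    ∃ w : V → ℝ, (∀ x, 0 ≤ w x) ∧ ∀ x, x ≠ b → 1 + ∑ z, K x z * w z ≤ w x := by
  obtain ⟨p0, hp0, hE⟩ := H.ell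
  set p : ℝ := min p0 1
  have hp : 0 < p := lt_min hp0 one_pos
  have hp1 : p ≤ 1 := min_le_right _ _
  set l : ℝ := p / 2
  have hl : 0 < l := by positivity
  have hl1 : l ≤ 1 := by simp only [l]; linarith
  obtain ⟨m, hm⟩ : ∃ m : ℕ, ∀ x, G.dist b x ≤ m :=
    ⟨univ.sup fun x => G.dist b x, fun x => Finset.le_sup (f := fun x => G.dist b x) (mem_univ x)⟩
  refine ⟨fun x => (l ^ m)⁻¹ * (1 - l ^ (G.dist b x)), fun x => ?_, fun x hx => ?_⟩
  · have : l ^ (G.dist b x) ≤ 1 := pow_le_one₀ hl.le hl1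
    have h2 : 0 ≤ (l ^ m)⁻¹ := by positivity
    exact mul_nonneg h2 (by linarith)
  · have hd : G.dist b x ≠ 0 := by
      intro h; exact hx ((H.conn.dist_eq_zero_iff).1 h).symm
    obtain ⟨k, hk⟩ := Nat.exists_eq_succ_of_ne_zero hd
    obtain ⟨y, hxy, hy⟩ : ∃ y, G.Adj x y ∧ G.dist b y ≤ k := by
      obtain ⟨q, hq⟩ := (H.conn.exists_walk_length_eq_dist x b)
      cases q with
      | nil => exact absurd rfl hx
      | cons h q' =>
        refine ⟨_, h, ?_⟩
        rw [SimpleGraph.Walk.length_cons, SimpleGraph.dist_comm, hk] at hq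
        have := SimpleGraph.dist_le q'
        rw [SimpleGraph.dist_comm]
        omega
    have e1 : ∑ z, K x z * ((l ^ m)⁻¹ * (1 - l ^ (G.dist b z)))
        = (l ^ m)⁻¹ * (1 - ∑ z, K x z * l ^ (G.dist b z)) := by
      have : ∀ z, K x z * ((l ^ m)⁻¹ * (1 - l ^ (G.dist b z)))
          = (l ^ m)⁻¹ * K x z - (l ^ m)⁻¹ * (K x z * l ^ (G.dist b z)) := fun z => by ring
      simp only [this, Finset.sum_sub_distrib, ← Finset.mul_sum, H.K1 x]
      ring
    have e2 : p * l ^ k ≤ ∑ z, K x z * l ^ (G.dist b z) := by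
      calc p * l ^ k ≤ K x y * l ^ (G.dist b y) := by
            apply mul_le_mul ((min_le_left _ _).trans (hE x y hxy)) _ (by positivity) (H.K0 _ _)
            exact pow_le_pow_of_le_one hl.le hl1 hy
        _ ≤ _ := Finset.single_le_sum (f := fun z => K x z * l ^ (G.dist b z))
            (fun z _ => mul_nonneg (H.K0 _ _) (by positivity)) (mem_univ y)
    have e3 : l ^ m ≤ l ^ (G.dist b x) := pow_le_pow_of_le_one hl.le hl1 (hm x)
    have e4 : p * l ^ k = 2 * l ^ (G.dist b x) := by
      rw [hk, pow_succ]; simp only [l]; ring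
    have hlm : 0 < l ^ m := by positivity
    simp only []
    rw [e1]
    have e5 : 1 ≤ (l ^ m)⁻¹ * l ^ (G.dist b x) := by
      rw [inv_mul_eq_div, le_div_iff₀ hlm]; linarith
    have e6 : (l ^ m)⁻¹ * (2 * l ^ (G.dist b x)) ≤
        (l ^ m)⁻¹ * ∑ z, K x z * l ^ (G.dist b z) := by
      apply mul_le_mul_of_nonneg_left _ (by positivity)
      linarith
    linarith

lemma avoid_summable (H : HS G K pi θ α c1 c2 CD CP N D) (b x : V) :
    Summable fun n => avoid K b n x := by
  obtain ⟨w, hw0, hw⟩ := exists_super H b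
  refine summable_of_sum_range_le (c := w x) (fun n => avoid_nonneg H b n x) ?_
  intro n
  induction n generalizing x with
  | zero => simpa using hw0 x
  | succ n ih =>
    rw [Finset.sum_range_succ']
    by_cases hx : x = b
    · simp [avoid, hx, hw0]
    · simp only [avoid, hx, if_false]
      rw [Finset.sum_comm]
      refine le_trans ?_ (hw x hx)
      rw [add_comm]
      gcongr with z _
      rw [← Finset.mul_sum]
      exact mul_le_mul_of_nonneg_left (ih z) (H.K0 _ _)

lemma hit_self (b : V) : hit K b b = 0 := by
  unfold hit
  have : ∀ n, avoid K b n b = 0 := by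
    intro n; cases n <;> simp [avoid]
  simp [this]

lemma hit_nonneg (H : HS G K pi θ α c1 c2 CD CP N D) (x b : V) : 0 ≤ hit K x b :=
  tsum_nonneg fun n => avoid_nonneg H b n x

lemma hit_eq (H : HS G K pi θ α c1 c2 CD CP N D) {x b : V} (hx : x ≠ b) :
    hit K x b = 1 + ∑ z, K x z * hit K z b := by
  unfold hit
  rw [(avoid_summable H b x).tsum_eq_zero_add]
  simp only [avoid, hx, if_false]
  congr 1
  rw [Summable.tsum_finsetSum]
  · refine Finset.sum_congr rfl fun z _ => ?_
    rw [tsum_mul_left]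
  · intro z _
    exact (avoid_summable H b z).mul_left _

lemma one_le_hit (H : HS G K pi θ α c1 c2 CD CP N D) {x b : V} (hx : x ≠ b) :
    1 ≤ hit K x b := by
  rw [hit_eq H hx]
  have : 0 ≤ ∑ z, K x z * hit K z b :=
    Finset.sum_nonneg fun z _ => mul_nonneg (H.K0 _ _) (hit_nonneg H z b)
  linarith

lemma edf_hit (H : HS G K pi θ α c1 c2 CD CP N D) (b : V) (g : V → ℝ) :
    edf K pi (fun x => hit K x b) g = 2 * (mean pi g - g b) := by
  have h1 := edf_green H (fun x => hit K x b) g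
  have h2 := edf_green H (fun x => hit K x b) (fun _ => g b)
  have h3 : edf K pi (fun x => hit K x b) (fun _ => g b) = 0 := by simp [edf]
  rw [h3] at h2
  have h4 : edf K pi (fun x => hit K x b) g
      = 2 * ∑ x, pi x * (hit K x b - ∑ y, K x y * hit K y b) * (g x - g b) := by
    rw [h1]
    simp only [mul_sub (_ * _) , Finset.sum_sub_distrib]
    linarith
  rw [h4]
  congr 1
  have h5 : mean pi g - g b = ∑ x, pi x * (g x - g b) := by
    simp only [mul_sub, Finset.sum_sub_distrib, mean]
    rw [← Finset.sum_mul, H.pi1, one_mul]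
  rw [h5]
  refine Finset.sum_congr rfl fun x _ => ?_
  by_cases hx : x = b
  · simp [hx]
  · have := hit_eq H hx
    have : hit K x b - ∑ y, K x y * hit K y b = 1 := by linarith
    rw [this, mul_one]

end hitting

section chain

variable {G : SimpleGraph V} {K : V → V → ℝ} {pi : V → ℝ} {θ α c1 c2 CD CP N D : ℝ}

/-- Truncations of `f` have energy controlled linearly by the height of the truncation. -/
def Clampy (K : V → V → ℝ) (pi : V → ℝ) (f : V → ℝ) : Prop :=
  ∀ s t : ℝ, 0 ≤ t →
    edf K pi (fun x => max s (min (f x) (s + t))) (fun x => max s (min (f x) (s + t))) ≤ 2 * t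

lemma clamp_contr (a b s e : ℝ) :
    (max s (min a e) - max s (min b e)) ^ 2 ≤ (a - b) * (max s (min a e) - max s (min b e)) := by
  have key : ∀ a b : ℝ, a ≤ b →
      (max s (min a e) - max s (min b e)) ^ 2
        ≤ (a - b) * (max s (min a e) - max s (min b e)) := by
    intro a b hab
    have h1 : max s (min a e) ≤ max s (min b e) := by gcongr
    have h2 : max s (min b e) - max s (min a e) ≤ b - a := by
      have : max s (min b e) ≤ max s (min a e) + (b - a) := by
        apply max_le
        · have := le_max_left s (min a e); linarith
        · have h3 := le_max_right s (min a e)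
          have : min b e ≤ min a e + (b - a) := by
            rcases le_total a e with h | h
            · rw [min_eq_left h]; have := min_le_left b e; linarith
            · rw [min_eq_right h]; have := min_le_right b e; linarith
          linarith
      linarith
    nlinarith
  rcases le_total a b with h | h
  · exact key a b h
  · have := key b a h
    nlinarith

lemma mean_le_of_le (H : HS G K pi θ α c1 c2 CD CP N D) {f : V → ℝ} {M : ℝ} (h : ∀ x, f x ≤ M) :
    mean pi f ≤ M := by
  unfold mean
  calc _ ≤ ∑ x, pi x * M := Finset.sum_le_sum fun x _ =>
        mul_le_mul_of_nonneg_left (h x) (H.pi0 x).le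
    _ = M := by rw [← Finset.sum_mul, H.pi1, one_mul]

lemma clampy_hit (H : HS G K pi θ α c1 c2 CD CP N D) (b : V) :
    Clampy K pi (fun x => hit K x b) := by
  intro s t ht
  refine (edf_mono_contr H (fun x => hit K x b) _ (fun x y => clamp_contr _ _ _ _)).trans ?_
  rw [edf_hit H]
  have h1 : mean pi (fun x => max s (min (hit K x b) (s + t))) ≤ s + t :=
    mean_le_of_le H fun x => max_le (by linarith) (min_le_right _ _)
  have h2 := le_max_left s (min (hit K b b) (s + t))
  linarith

lemma Clampy.neg {f : V → ℝ} (hf : Clampy K pi f) : Clampy K pi (fun x => - f x) := by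
  intro s t ht
  have h := hf (-s - t) t ht
  have e : ∀ x, max s (min (-f x) (s + t)) = - max (-s - t) (min (f x) (-s - t + t)) := by
    intro x
    rcases le_total (f x) (-s) with h1 | h1
    · rcases le_total (-s-t) (f x) with h2 | h2
      · rw [min_eq_left (a := f x) (by linarith), max_eq_right h2, min_eq_left (by linarith),
          max_eq_right (by linarith)]
      · rw [min_eq_left (a := f x) (by linarith), max_eq_left h2, min_eq_right (by linarith),
          max_eq_right (by linarith)]; ring
    · rw [min_eq_left (a := - f x) (by linarith), max_eq_left (a := s) (by linarith),
        min_eq_right (a := f x) (by linarith), max_eq_right (by linarith)]; ring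
  have e2 : edf K pi (fun x => max s (min (-f x) (s + t))) (fun x => max s (min (-f x) (s + t)))
      = edf K pi (fun x => max (-s - t) (min (f x) (-s - t + t)))
        (fun x => max (-s - t) (min (f x) (-s - t + t))) := by
    unfold edf
    refine Finset.sum_congr rfl fun x _ => Finset.sum_congr rfl fun y _ => ?_
    simp only [e]; ring
  rw [e2]; exact h

lemma chain_step (H : HS G K pi θ α c1 c2 CD CP N D) {f : V → ℝ} (hf : Clampy K pi f) (x : V)
    {ρ s t : ℝ} (h1 : 1 ≤ ρ) (h2 : ρ ≤ 2 * D) (ht0 : 0 < t)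
    (ht : 24 * CP * CD / c1 * N * ρ ^ (θ - α) < t)
    (hA : 2 / 3 * vol G pi x (ρ / 2) ≤ ∑ z ∈ (gball G x (ρ / 2)).filter (fun z => f z ≤ s), pi z) :
    2 / 3 * vol G pi x ρ ≤ ∑ z ∈ (gball G x ρ).filter (fun z => f z ≤ s + t), pi z := by
  by_contra hcon
  push Not at hcon
  have hρ : 0 < ρ := by linarith
  have hsplit := Finset.sum_filter_add_sum_filter_not (gball G x ρ) (fun z => f z ≤ s + t) pi
  have hW : 0 < vol G pi x ρ := vol_pos H x hρ.le
  have hCD := one_le_CD H x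
  have hCDp := H.CDpos
  have hCP := H.CPpos
  have hc1 := H.c1pos
  have hN := H.Npos
  change _ = vol G pi x ρ at hsplit
  set u : V → ℝ := fun x => max s (min (f x) (s + t)) with hu
  set c := ballAvg G pi x ρ u with hc
  have hPI := (pi_ball H x ρ hρ u).trans (mul_le_mul_of_nonneg_left
    ((eball_le_edf H x ρ u).trans (hf s t ht0.le)) (by positivity))
  have hVD := H.VD x (ρ / 2) (by linarith)
  rw [show 2 * (ρ / 2) = ρ by ring] at hVD
  have hlow : t ^ 2 / 4 * (vol G pi x ρ / (3 * CD)) ≤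
      ∑ z ∈ gball G x ρ, (u z - c) ^ 2 * pi z := by
    rcases le_total (s + t / 2) c with hcc | hcc
    · calc t ^ 2 / 4 * (vol G pi x ρ / (3 * CD))
          ≤ t ^ 2 / 4 * ∑ z ∈ (gball G x (ρ / 2)).filter (fun z => f z ≤ s), pi z := by
            gcongr
            refine le_trans ?_ hA
            rw [div_le_iff₀ (by positivity)]
            have := vol_pos H x (r := ρ / 2) (by linarith)
            nlinarith
        _ ≤ ∑ z ∈ (gball G x (ρ / 2)).filter (fun z => f z ≤ s), (u z - c) ^ 2 * pi z := by
            rw [Finset.mul_sum]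
            refine Finset.sum_le_sum fun z hz => ?_
            refine mul_le_mul_of_nonneg_right ?_ (H.pi0 z).le
            have hz2 := (Finset.mem_filter.1 hz).2
            have : u z = s := by
              simp only [hu]; rw [min_eq_left (by linarith), max_eq_left hz2]
            rw [this]; nlinarith
        _ ≤ _ := by
            refine Finset.sum_le_sum_of_subset_of_nonneg ?_
              (fun z _ _ => mul_nonneg (sq_nonneg _) (H.pi0 z).le)
            intro z hz
            have := (Finset.mem_filter.1 hz).1
            rw [mem_gball] at this ⊢
            linarith
    · calc t ^ 2 / 4 * (vol G pi x ρ / (3 * CD))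
          ≤ t ^ 2 / 4 * ∑ z ∈ (gball G x ρ).filter (fun z => ¬ f z ≤ s + t), pi z := by
            gcongr
            rw [div_le_iff₀ (by positivity)]
            nlinarith
        _ ≤ ∑ z ∈ (gball G x ρ).filter (fun z => ¬ f z ≤ s + t), (u z - c) ^ 2 * pi z := by
            rw [Finset.mul_sum]
            refine Finset.sum_le_sum fun z hz => ?_
            refine mul_le_mul_of_nonneg_right ?_ (H.pi0 z).le
            have hz2 := (Finset.mem_filter.1 hz).2
            push Not at hz2
            have : u z = s + t := by
              simp only [hu]; rw [min_eq_right hz2.le, max_eq_right (by linarith)]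
            rw [this]; nlinarith
        _ ≤ _ := by
            refine Finset.sum_le_sum_of_subset_of_nonneg (Finset.filter_subset _ _)
              (fun z _ _ => mul_nonneg (sq_nonneg _) (H.pi0 z).le)
  have h3 := hlow.trans hPI
  have h4 : t * vol G pi x ρ ≤ 24 * CP * CD * ρ ^ θ := by
    have e : t ^ 2 / 4 * (vol G pi x ρ / (3 * CD)) = t * (t * vol G pi x ρ) / (12 * CD) := by
      field_simp; ring
    rw [e, div_le_iff₀ (by positivity)] at h3
    have : t * (t * vol G pi x ρ) ≤ t * (24 * CP * CD * ρ ^ θ) := by linarith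
    exact le_of_mul_le_mul_left this ht0
  have h5 := H.vlow x ρ h1 h2
  have h6 : t * (c1 * ρ ^ α) ≤ N * (24 * CP * CD * ρ ^ θ) := by
    calc t * (c1 * ρ ^ α) ≤ t * (N * vol G pi x ρ) := by gcongr
      _ = N * (t * vol G pi x ρ) := by ring
      _ ≤ _ := by gcongr
  rw [Real.rpow_sub hρ] at ht
  have hρα : 0 < ρ ^ α := Real.rpow_pos_of_pos hρ _
  have e7 : 24 * CP * CD / c1 * N * (ρ ^ θ / ρ ^ α) = (N * (24 * CP * CD * ρ ^ θ)) / (c1 * ρ ^ α) := by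
    field_simp
  rw [e7, div_lt_iff₀ (by positivity)] at ht
  linarith

/-- The accumulated height after `j` steps. -/
noncomputable def Tsum (θ α c1 CD CP N : ℝ) (j : ℕ) : ℝ :=
  25 * CP * CD / c1 * N * ∑ i ∈ Finset.range j, ((2 : ℝ) ^ (θ - α)) ^ i

lemma chain (H : HS G K pi θ α c1 c2 CD CP N D) {f : V → ℝ} (hf : Clampy K pi f) (x : V)
    (J : ℕ) (hJ : (2 : ℝ) ^ J ≤ 2 * D) :
    2 / 3 * vol G pi x ((2 : ℝ) ^ J) ≤ ∑ z ∈ (gball G x ((2 : ℝ) ^ J)).filter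
      (fun z => f z ≤ f x + Tsum θ α c1 CD CP N (J + 1)), pi z := by
  have hCP := H.CPpos
  have hCD := H.CDpos
  have hc1 := H.c1pos
  have hN := H.Npos
  have step : ∀ j : ℕ, (2 : ℝ) ^ j ≤ 2 * D →
    (2 / 3 * vol G pi x ((2 : ℝ) ^ j / 2) ≤ ∑ z ∈ (gball G x ((2 : ℝ) ^ j / 2)).filter
      (fun z => f z ≤ f x + Tsum θ α c1 CD CP N j), pi z) →
    2 / 3 * vol G pi x ((2 : ℝ) ^ j) ≤ ∑ z ∈ (gball G x ((2 : ℝ) ^ j)).filter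
      (fun z => f z ≤ f x + Tsum θ α c1 CD CP N (j + 1)), pi z := by
    intro j hj h
    have e : Tsum θ α c1 CD CP N (j + 1) =
        Tsum θ α c1 CD CP N j + 25 * CP * CD / c1 * N * ((2 : ℝ) ^ j) ^ (θ - α) := by
      unfold Tsum
      rw [Finset.sum_range_succ, mul_add]
      congr 2
      rw [← Real.rpow_natCast, ← Real.rpow_natCast, ← Real.rpow_mul (by norm_num),
        ← Real.rpow_mul (by norm_num), mul_comm]
    have hq : 0 < CP * CD / c1 * N * ((2 : ℝ) ^ j) ^ (θ - α) := by positivity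
    rw [e, ← add_assoc]
    refine chain_step H hf x (one_le_pow₀ (by norm_num)) hj ?_ ?_ h
    · have : 25 * CP * CD / c1 * N * ((2 : ℝ) ^ j) ^ (θ - α)
        = 25 * (CP * CD / c1 * N * ((2 : ℝ) ^ j) ^ (θ - α)) := by ring
      linarith
    · have : 25 * CP * CD / c1 * N * ((2 : ℝ) ^ j) ^ (θ - α)
        = 25 * (CP * CD / c1 * N * ((2 : ℝ) ^ j) ^ (θ - α)) := by ring
      have : 24 * CP * CD / c1 * N * ((2 : ℝ) ^ j) ^ (θ - α)
        = 24 * (CP * CD / c1 * N * ((2 : ℝ) ^ j) ^ (θ - α)) := by ring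
      linarith
  induction J with
  | zero =>
    refine step 0 hJ ?_
    have e : (2 : ℝ) ^ 0 / 2 = 1 / 2 := by norm_num
    rw [e]
    unfold vol
    rw [gball_half H x]
    have : Finset.filter (fun z => f z ≤ f x + Tsum θ α c1 CD CP N 0) {x} = {x} := by
      ext z; simp only [Finset.mem_filter, Finset.mem_singleton, and_iff_left_iff_imp]
      rintro rfl; simp [Tsum]
    rw [this]
    have := H.pi0 x
    simp; linarith
  | succ J ih =>
    refine step (J + 1) hJ ?_
    have e : (2 : ℝ) ^ (J + 1) / 2 = 2 ^ J := by rw [pow_succ]; ring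
    rw [e]
    refine ih (le_trans ?_ hJ)
    exact pow_le_pow_right₀ (by norm_num) (Nat.le_succ J)

lemma exists_J (hD : 1 ≤ D) : ∃ J : ℕ, D ≤ (2 : ℝ) ^ J ∧ (2 : ℝ) ^ J ≤ 2 * D := by
  obtain ⟨n, hn⟩ := exists_nat_pow_near (x := D) (y := (2 : ℝ)) hD (by norm_num)
  refine ⟨n + 1, hn.2.le, ?_⟩
  rw [pow_succ]; linarith [hn.1]

lemma hit_upper (H : HS G K pi θ α c1 c2 CD CP N D) (a b : V) (J : ℕ)
    (hJ0 : D ≤ (2 : ℝ) ^ J) (hJ : (2 : ℝ) ^ J ≤ 2 * D) :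
    hit K a b ≤ 2 * Tsum θ α c1 CD CP N (J + 1) := by
  have hA := chain H (clampy_hit H b) b J hJ
  have hB := chain H (clampy_hit H b).neg a J hJ
  rw [vol_univ H _ hJ0, gball_univ H _ hJ0] at hA hB
  rw [hit_self] at hA
  by_contra hcon
  push Not at hcon
  set A := univ.filter (fun z => hit K z b ≤ 0 + Tsum θ α c1 CD CP N (J + 1))
  set B := univ.filter (fun z => -hit K z b ≤ -hit K a b + Tsum θ α c1 CD CP N (J + 1))
  have hdis : Disjoint A B := by
    rw [Finset.disjoint_left]
    intro z hz hz'
    have h1 := (Finset.mem_filter.1 hz).2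
    have h2 := (Finset.mem_filter.1 hz').2
    linarith
  have h1 : ∑ z ∈ A ∪ B, pi z ≤ 1 := by
    rw [← H.pi1]
    exact Finset.sum_le_sum_of_subset_of_nonneg (subset_univ _) (fun z _ _ => (H.pi0 z).le)
  rw [Finset.sum_union hdis] at h1
  linarith

end chain

section lower

variable {G : SimpleGraph V} {K : V → V → ℝ} {pi : V → ℝ} {θ α c1 c2 CD CP N D : ℝ}

lemma trial (H : HS G K pi θ α c1 c2 CD CP N D) (b : V) (f : V → ℝ) :
    2 * (mean pi f - f b) ^ 2 ≤ mean pi (fun x => hit K x b) * edf K pi f f := by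
  have h1 := edf_cs H (fun x => hit K x b) f
  rw [edf_hit H, edf_hit H, hit_self] at h1
  nlinarith

lemma cutoff (H : HS G K pi θ α c1 c2 CD CP N D) {C1 C2 ε : ℝ} (hC2 : 0 < C2)
    (CS : CondCS G K pi θ C1 C2 ε) (x : V) {r : ℝ} (hr : 1 ≤ r) :
    ∃ σ : V → ℝ, (∀ y ∈ gball G x (r / 2), σ y = 1) ∧ (∀ y, y ∉ gball G x r → σ y = 0) ∧
      (∀ y, σ y ≤ 1) ∧ edf K pi σ σ ≤ 2 * C2 * c2 * 2 ^ α / N * r ^ (α - θ) := by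
  have hr0 : 0 < r := by linarith
  obtain ⟨σ, ha, hb, -, hd⟩ := CS x r hr0
  have hN := H.Npos
  refine ⟨fun y => min (σ y) 1, fun y hy => min_eq_right (ha y hy), fun y hy => ?_,
    fun y => min_le_right _ _, ?_⟩
  · simp [hb y hy]
  have h1 := hd r hr0 le_rfl (fun _ => 1)
  simp only [abs_one, one_pow, one_mul, sub_self, abs_zero, ne_eq, OfNat.ofNat_ne_zero,
    not_false_eq_true, zero_pow, zero_mul, ite_self, Finset.sum_const_zero, zero_add,
    div_self hr0.ne', Real.one_rpow, mul_one, sq_abs] at h1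
  have h2 : ∑ z ∈ gball G x r, ∑ y, (σ z - σ y) ^ 2 * (K z y * pi z)
      ≤ C2 * (r ^ (-θ) * vol G pi x (2 * r)) := by
    refine le_trans (le_of_eq ?_) h1
    refine Finset.sum_congr rfl fun ξ _ => Finset.sum_congr rfl fun ζ _ => ?_
    by_cases ha : G.Adj ξ ζ
    · simp [ha, mul_assoc]
    · by_cases he : ξ = ζ
      · simp [he]
      · simp [ha, H.Koff ξ ζ he ha]
  set q : V → V → ℝ := fun z y => (σ z - σ y) ^ 2 * (K z y * pi z) with hq
  have hq0 : ∀ z y, 0 ≤ q z y := fun z y => mul_nonneg (sq_nonneg _) (w_nonneg H z y)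
  have hqs : ∀ z y, q z y = q y z := fun z y => by
    simp only [hq]; have := H.rev z y; rw [mul_comm (K z y), this]; ring
  have h3 : edf K pi (fun y => min (σ y) 1) (fun y => min (σ y) 1)
      ≤ ∑ z, ∑ y, ((if z ∈ gball G x r then q z y else 0)
          + (if y ∈ gball G x r then q y z else 0)) := by
    unfold edf
    refine Finset.sum_le_sum fun z _ => Finset.sum_le_sum fun y _ => ?_
    have e1 : (min (σ z) 1 - min (σ y) 1) * (min (σ z) 1 - min (σ y) 1) * (K z y * pi z) ≤ q z y := by
      simp only [hq]
      refine mul_le_mul_of_nonneg_right ?_ (w_nonneg H z y)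
      rw [← sq]
      apply sq_le_sq.2
      have := abs_min_sub_min_le_max (σ z) 1 (σ y) 1
      simpa using this
    by_cases hz : z ∈ gball G x r
    · simp only [hz, if_true]
      have : 0 ≤ (if y ∈ gball G x r then q y z else 0) := by split_ifs; exacts [hq0 _ _, le_rfl]
      linarith
    · by_cases hy : y ∈ gball G x r
      · simp only [hz, hy, if_true, if_false, zero_add]
        rw [← hqs z y]; exact e1
      · simp [hz, hy, hb z hz, hb y hy]
  have h4 : ∑ z, ∑ y, ((if z ∈ gball G x r then q z y else 0)
          + (if y ∈ gball G x r then q y z else 0)) = 2 * ∑ z ∈ gball G x r, ∑ y, q z y := by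
    simp only [Finset.sum_add_distrib]
    rw [Finset.sum_comm (f := fun z y => if y ∈ gball G x r then q y z else 0), ← two_mul]
    congr 1
    rw [← Finset.sum_filter_add_sum_filter_not univ (fun z => z ∈ gball G x r)]
    have : ∑ z ∈ univ.filter (fun z => ¬ z ∈ gball G x r), ∑ y, (if z ∈ gball G x r then q z y else 0) = 0 := by
      refine Finset.sum_eq_zero fun z hz => Finset.sum_eq_zero fun y _ => ?_
      simp [(Finset.mem_filter.1 hz).2]
    rw [this, add_zero]
    have e : univ.filter (fun z => z ∈ gball G x r) = gball G x r := by ext; simp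
    rw [e]
    refine Finset.sum_congr rfl fun z hz => Finset.sum_congr rfl fun y _ => ?_
    simp [hz]
  have h5 := H.vup x (2 * r) (by linarith)
  refine h3.trans (h4.le.trans ?_)
  have h6 : vol G pi x (2 * r) ≤ c2 * (2 * r) ^ α / N := by
    rw [le_div_iff₀ hN, mul_comm]; exact h5
  calc 2 * ∑ z ∈ gball G x r, ∑ y, q z y ≤ 2 * (C2 * (r ^ (-θ) * (c2 * (2 * r) ^ α / N))) := by
        refine mul_le_mul_of_nonneg_left (h2.trans ?_) (by norm_num)
        gcongr
    _ = _ := by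
        rw [Real.mul_rpow (by norm_num) hr0.le, sub_eq_add_neg, Real.rpow_add hr0]; ring

lemma mean_lower_of_trial (H : HS G K pi θ α c1 c2 CD CP N D) (b : V) (f : V → ℝ) {k e R : ℝ}
    (hk : 0 < k) (hf0 : ∀ x, 0 ≤ f x) (hfb : f b = 0) (hR : 1 ≤ R)
    (hout : ∀ x, x ∉ gball G b R → f x = k)
    (hvol : 2 * c2 * R ^ α ≤ N) (he : edf K pi f f ≤ e) :
    k ^ 2 / 2 ≤ mean pi (fun x => hit K x b) * e := by
  have hN := H.Npos
  have h1 := trial H b f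
  have hm0 : 0 ≤ mean pi (fun x => hit K x b) :=
    Finset.sum_nonneg fun x _ => mul_nonneg (H.pi0 x).le (hit_nonneg H x b)
  have h2 : vol G pi b R ≤ 1 / 2 := by
    have := H.vup b R hR
    have h3 : N * vol G pi b R ≤ N * (1 / 2) := by linarith
    exact le_of_mul_le_mul_left h3 hN
  have h3 : k / 2 ≤ mean pi f := by
    have hs := Finset.sum_filter_add_sum_filter_not univ (fun z => z ∈ gball G b R) pi
    have e : univ.filter (fun z => z ∈ gball G b R) = gball G b R := by ext; simp
    rw [e, H.pi1] at hs
    change vol G pi b R + _ = 1 at hs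
    calc k / 2 ≤ k * ∑ z ∈ univ.filter (fun z => ¬ z ∈ gball G b R), pi z := by nlinarith
      _ = ∑ z ∈ univ.filter (fun z => ¬ z ∈ gball G b R), pi z * f z := by
          rw [Finset.mul_sum]
          refine Finset.sum_congr rfl fun z hz => ?_
          rw [hout z (Finset.mem_filter.1 hz).2, mul_comm]
      _ ≤ _ := Finset.sum_le_sum_of_subset_of_nonneg (subset_univ _)
          (fun z _ _ => mul_nonneg (H.pi0 z).le (hf0 z))
  rw [hfb, sub_zero] at h1
  have h4 := mul_le_mul_of_nonneg_left he hm0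
  nlinarith

lemma mean_lower_gt (H : HS G K pi θ α c1 c2 CD CP N D) {C1 C2 ε : ℝ} (hC2 : 0 < C2)
    (CS : CondCS G K pi θ C1 C2 ε) (b : V) (hN : 2 * c2 ≤ N) :
    N ≤ mean pi (fun x => hit K x b) * (4 * C2 * c2 * 2 ^ α) := by
  obtain ⟨σ, s1, s2, s3, s4⟩ := cutoff H hC2 CS b le_rfl
  have hN0 := H.Npos
  have he : edf K pi (fun x => 1 - σ x) (fun x => 1 - σ x) ≤ 2 * C2 * c2 * 2 ^ α / N := by
    rw [Real.one_rpow, mul_one] at s4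
    refine le_trans (le_of_eq ?_) s4
    unfold edf
    refine Finset.sum_congr rfl fun x _ => Finset.sum_congr rfl fun y _ => ?_
    ring
  have := mean_lower_of_trial H b (fun x => 1 - σ x) (k := 1) (R := 1) one_pos
    (fun x => by linarith [s3 x]) (by simp [s1 b (self_mem_gball (by norm_num))]) le_rfl
    (fun x hx => by simp [s2 x hx]) (by simpa using hN) he
  rw [← mul_div_assoc, le_div_iff₀ hN0] at this
  linarith

lemma mean_lower_log (H : HS G K pi θ α c1 c2 CD CP N D) {C1 C2 ε : ℝ} (hC2 : 0 < C2)
    (CS : CondCS G K pi θ C1 C2 ε) (b : V) (hαθ : α = θ) (k : ℕ) (hk : 0 < k)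
    (hN : 2 * c2 * ((8 : ℝ) ^ k) ^ α ≤ N) :
    k * N ≤ mean pi (fun x => hit K x b) * (4 * C2 * c2 * 2 ^ α) := by
  have hN0 := H.Npos
  have hr : ∀ i : ℕ, (1 : ℝ) ≤ 8 ^ (i + 1) := fun i => one_le_pow₀ (by norm_num)
  choose σ s1 s2 s3 s4 using fun i : ℕ => cutoff H hC2 CS b (hr i)
  set f : V → ℝ := fun x => ∑ i ∈ Finset.range k, (1 - σ i x) with hf
  -- an edge sees at most one of the cut-offs
  have hone : ∀ x y, (x = y ∨ G.Adj x y) → ∀ i j, i < j →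
      (σ i x - σ i y) * (σ j x - σ j y) = 0 := by
    intro x y hxy i j hij
    by_contra hne
    have hi : σ i x ≠ σ i y := fun h => hne (by rw [h]; ring)
    have hj : σ j x ≠ σ j y := fun h => hne (by rw [h]; ring)
    have hd : (G.dist b x : ℝ) ≤ G.dist b y + 1 ∧ (G.dist b y : ℝ) ≤ G.dist b x + 1 := by
      rcases hxy with rfl | hadj
      · constructor <;> linarith
      · have h1 : G.dist x y = 1 := SimpleGraph.dist_eq_one_iff_adj.2 hadj
        have h2 := H.conn.dist_triangle (u := b) (v := x) (w := y)
        have h3 := H.conn.dist_triangle (u := b) (v := y) (w := x)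
        rw [SimpleGraph.dist_comm (u := y), h1] at h3
        rw [h1] at h2
        constructor <;> exact_mod_cast by omega
    have h8 : (8 : ℝ) ^ (j + 1) ≥ 8 * 8 ^ (i + 1) := by
      rw [← pow_succ']; exact pow_le_pow_right₀ (by norm_num) (by omega)
    have h8' := hr i
    -- small distance because of `i`
    have hsm : (G.dist b x : ℝ) ≤ 8 ^ (i + 1) ∨ (G.dist b y : ℝ) ≤ 8 ^ (i + 1) := by
      by_contra hc
      push Not at hc
      exact hi (by rw [s2 i x (by rw [mem_gball]; push Not; exact hc.1),
        s2 i y (by rw [mem_gball]; push Not; exact hc.2)])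
    apply hj
    rw [s1 j x (by rw [mem_gball]; rcases hsm with h | h <;> linarith [hd.1, hd.2]),
      s1 j y (by rw [mem_gball]; rcases hsm with h | h <;> linarith [hd.1, hd.2])]
  have hcross : ∀ i j, i ≠ j → edf K pi (σ i) (σ j) = 0 := by
    intro i j hij
    unfold edf
    refine Finset.sum_eq_zero fun x _ => Finset.sum_eq_zero fun y _ => ?_
    by_cases hxy : x = y ∨ G.Adj x y
    · rcases lt_or_gt_of_ne hij with h | h
      · rw [hone x y hxy i j h, zero_mul]
      · rw [mul_comm (σ i x - σ i y), hone x y hxy j i h, zero_mul]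
    · push Not at hxy
      rw [H.Koff x y hxy.1 hxy.2]; ring
  have hexp : edf K pi f f = ∑ i ∈ Finset.range k, ∑ j ∈ Finset.range k, edf K pi (σ i) (σ j) := by
    have hfd : ∀ x y, f x - f y = ∑ i ∈ Finset.range k, -(σ i x - σ i y) := by
      intro x y
      simp only [hf]; rw [← Finset.sum_sub_distrib]
      exact Finset.sum_congr rfl fun i _ => by ring
    unfold edf
    have : ∀ x y, (f x - f y) * (f x - f y) * (K x y * pi x) = ∑ i ∈ Finset.range k,
        ∑ j ∈ Finset.range k, (σ i x - σ i y) * (σ j x - σ j y) * (K x y * pi x) := by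
      intro x y
      rw [hfd, Finset.sum_mul_sum, Finset.sum_mul]
      refine Finset.sum_congr rfl fun i _ => ?_
      rw [Finset.sum_mul]
      exact Finset.sum_congr rfl fun j _ => by ring
    simp only [this]
    have e1 : ∀ x, ∑ y, ∑ i ∈ Finset.range k,
        ∑ j ∈ Finset.range k, (σ i x - σ i y) * (σ j x - σ j y) * (K x y * pi x)
        = ∑ i ∈ Finset.range k,
        ∑ j ∈ Finset.range k, ∑ y, (σ i x - σ i y) * (σ j x - σ j y) * (K x y * pi x) := by
      intro x
      rw [Finset.sum_comm]
      exact Finset.sum_congr rfl fun i _ => Finset.sum_comm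
    simp only [e1]
    rw [Finset.sum_comm]
    exact Finset.sum_congr rfl fun i _ => Finset.sum_comm
  have he : edf K pi f f ≤ k * (2 * C2 * c2 * 2 ^ α / N) := by
    rw [hexp]
    calc _ = ∑ i ∈ Finset.range k, edf K pi (σ i) (σ i) := by
          refine Finset.sum_congr rfl fun i hi => ?_
          refine Finset.sum_eq_single_of_mem i hi ?_
          intro j _ hji
          exact hcross i j hji.symm
      _ ≤ ∑ i ∈ Finset.range k, (2 * C2 * c2 * 2 ^ α / N) := by
          refine Finset.sum_le_sum fun i _ => ?_
          have := s4 i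
          rw [show α - θ = 0 by rw [hαθ]; ring, Real.rpow_zero, mul_one] at this
          exact this
      _ = _ := by simp
  have hk0 : (0 : ℝ) < k := by exact_mod_cast hk
  have := mean_lower_of_trial H b f (k := k) (R := 8 ^ k) hk0
    (fun x => Finset.sum_nonneg fun i _ => by linarith [s3 i x])
    (by
      refine Finset.sum_eq_zero fun i _ => ?_
      rw [s1 i b (self_mem_gball (by linarith [hr i]))]; ring)
    (one_le_pow₀ (by norm_num))
    (fun x hx => by
      have : ∀ i ∈ Finset.range k, 1 - σ i x = 1 := by
        intro i hi
        rw [s2 i x, sub_zero]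
        rw [mem_gball] at hx ⊢
        push Not at hx ⊢
        refine lt_of_le_of_lt ?_ hx
        exact pow_le_pow_right₀ (by norm_num) (by have := Finset.mem_range.1 hi; omega)
      simp only [hf]
      rw [Finset.sum_congr rfl this]; simp) hN he
  have h2 : (k : ℝ) * (k / 2) ≤ k * (mean pi (fun x => hit K x b) * (2 * C2 * c2 * 2 ^ α) / N) := by
    calc (k : ℝ) * (k / 2) = k ^ 2 / 2 := by ring
      _ ≤ _ := this
      _ = _ := by ring
  have h3 := le_of_mul_le_mul_left h2 hk0
  rw [le_div_iff₀ hN0] at h3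
  linarith

end lower

section frostman

variable {G : SimpleGraph V} {K : V → V → ℝ} {pi : V → ℝ} {θ α c1 c2 CD CP N D : ℝ}

lemma jensen (H : HS G K pi θ α c1 c2 CD CP N D) (x : V) {r : ℝ} (hr : 0 ≤ r) (u : V → ℝ) (c : ℝ) :
    vol G pi x r * (ballAvg G pi x r u - c) ^ 2 ≤ ∑ z ∈ gball G x r, (u z - c) ^ 2 * pi z := by
  have hv := vol_pos H x hr
  have e : ballAvg G pi x r u - c = (vol G pi x r)⁻¹ * ∑ z ∈ gball G x r, (u z - c) * pi z := by
    unfold ballAvg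
    have : ∑ z ∈ gball G x r, (u z - c) * pi z
        = ∑ z ∈ gball G x r, u z * pi z - c * vol G pi x r := by
      unfold vol
      rw [Finset.mul_sum, ← Finset.sum_sub_distrib]
      exact Finset.sum_congr rfl fun z _ => by ring
    rw [this]; field_simp
  have h1 : (∑ z ∈ gball G x r, (u z - c) * pi z) ^ 2 ≤
      (∑ z ∈ gball G x r, (u z - c) ^ 2 * pi z) * vol G pi x r := by
    unfold vol
    refine Finset.sum_sq_le_sum_mul_sum_of_sq_le_mul _ ?_ ?_ ?_
    · intro z _; exact mul_nonneg (sq_nonneg _) (H.pi0 z).le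
    · intro z _; exact (H.pi0 z).le
    · intro z _; exact le_of_eq (by ring)
  rw [e, mul_pow]
  have : vol G pi x r * ((vol G pi x r)⁻¹ ^ 2 * (∑ z ∈ gball G x r, (u z - c) * pi z) ^ 2)
      = (∑ z ∈ gball G x r, (u z - c) * pi z) ^ 2 / vol G pi x r := by
    field_simp
  rw [this, div_le_iff₀ hv]
  exact h1

lemma ballstep (H : HS G K pi θ α c1 c2 CD CP N D) (x : V) {ρ : ℝ} (h1 : 1 ≤ ρ) (h2 : ρ ≤ 2 * D)
    (u : V → ℝ) :
    (ballAvg G pi x ρ u - ballAvg G pi x (ρ / 2) u) ^ 2 ≤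
      CP * CD / c1 * N * ρ ^ (θ - α) * eball G K pi x ρ u := by
  have hρ : 0 < ρ := by linarith
  have hCD := H.CDpos
  have hCP := H.CPpos
  have hc1 := H.c1pos
  have hN := H.Npos
  have hj := jensen H x (r := ρ / 2) (by linarith) u (ballAvg G pi x ρ u)
  have hPI := pi_ball H x ρ hρ u
  have hVD := H.VD x (ρ / 2) (by linarith)
  rw [show 2 * (ρ / 2) = ρ by ring] at hVD
  have hv := H.vlow x ρ h1 h2
  have hsub : ∑ z ∈ gball G x (ρ / 2), (u z - ballAvg G pi x ρ u) ^ 2 * pi z ≤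
      ∑ z ∈ gball G x ρ, (u z - ballAvg G pi x ρ u) ^ 2 * pi z := by
    refine Finset.sum_le_sum_of_subset_of_nonneg ?_
      (fun z _ _ => mul_nonneg (sq_nonneg _) (H.pi0 z).le)
    intro z hz
    rw [mem_gball] at hz ⊢
    linarith
  have h3 := hj.trans (hsub.trans hPI)
  set X := (ballAvg G pi x (ρ / 2) u - ballAvg G pi x ρ u) ^ 2 with hX
  have hX0 : 0 ≤ X := sq_nonneg _
  have e : (ballAvg G pi x ρ u - ballAvg G pi x (ρ / 2) u) ^ 2 = X := by rw [hX]; ring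
  rw [e]
  have h4 : c1 * ρ ^ α * X ≤ N * CD * (CP * ρ ^ θ * eball G K pi x ρ u) := by
    calc c1 * ρ ^ α * X ≤ N * vol G pi x ρ * X := by gcongr
      _ ≤ N * (CD * vol G pi x (ρ / 2)) * X := by gcongr
      _ = N * CD * (vol G pi x (ρ / 2) * X) := by ring
      _ ≤ _ := by gcongr
  have hρα : 0 < ρ ^ α := Real.rpow_pos_of_pos hρ _
  rw [Real.rpow_sub hρ]
  have e2 : CP * CD / c1 * N * (ρ ^ θ / ρ ^ α) * eball G K pi x ρ u
      = (N * CD * (CP * ρ ^ θ * eball G K pi x ρ u)) / (c1 * ρ ^ α) := by field_simp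
  rw [e2, le_div_iff₀ (by positivity)]
  linarith

lemma exists_sphere (H : HS G K pi θ α c1 c2 CD CP N D) (a b : V) (k : ℕ) (hk : k ≤ G.dist b a) :
    ∃ x, G.dist b x = k ∧ hit K x b ≤ hit K a b := by
  obtain ⟨x, hx, hmin⟩ := Finset.exists_min_image (univ.filter fun x => k ≤ G.dist b x)
    (fun x => hit K x b) ⟨a, by simp [hk]⟩
  simp only [Finset.mem_filter, mem_univ, true_and] at hx hmin
  refine ⟨x, ?_, hmin a hk⟩
  by_contra hne
  have hlt : k < G.dist b x := lt_of_le_of_ne hx (Ne.symm hne)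
  have hxb : x ≠ b := by
    rintro rfl; simp at hlt
  have h1 := hit_eq H hxb
  have h2 : hit K x b ≤ ∑ z, K x z * hit K z b := by
    calc hit K x b = ∑ z, K x z * hit K x b := by rw [← Finset.sum_mul, H.K1, one_mul]
      _ ≤ _ := by
        refine Finset.sum_le_sum fun z _ => ?_
        by_cases hxz : x = z
        · rw [hxz]
        · by_cases hadj : G.Adj x z
          · refine mul_le_mul_of_nonneg_left (hmin z ?_) (H.K0 _ _)
            have h3 := H.conn.dist_triangle (u := b) (v := z) (w := x)
            have h4 : G.dist x z = 1 := SimpleGraph.dist_eq_one_iff_adj.2 hadj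
            rw [SimpleGraph.dist_comm (u := z), h4] at h3
            omega
          · rw [H.Koff x z hxz hadj]; simp
  linarith

lemma count_energy (H : HS G K pi θ α c1 c2 CD CP N D) (b : V) (M : ℕ) (p : ℕ → V)
    (hp : ∀ k ∈ Finset.range M, G.dist b (p k) = k) (r : ℕ) (u : V → ℝ) :
    ∑ k ∈ Finset.range M, eball G K pi (p k) r u ≤ (2 * r + 1) * edf K pi u u := by
  set g : V → ℝ := fun ξ => ∑ ζ, (u ξ - u ζ) ^ 2 * (K ξ ζ * pi ξ) with hg
  have hg0 : ∀ ξ, 0 ≤ g ξ := fun ξ => Finset.sum_nonneg fun ζ _ =>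
    mul_nonneg (sq_nonneg _) (w_nonneg H _ _)
  calc ∑ k ∈ Finset.range M, eball G K pi (p k) r u
      ≤ ∑ k ∈ Finset.range M, ∑ ξ, if (G.dist (p k) ξ ≤ r) then g ξ else 0 := by
        refine Finset.sum_le_sum fun k _ => ?_
        rw [← Finset.sum_filter]
        have : univ.filter (fun ξ => G.dist (p k) ξ ≤ r) = gball G (p k) r := by
          ext z; simp [mem_gball]
        rw [this]
        unfold eball
        refine Finset.sum_le_sum fun ξ _ => ?_
        exact Finset.sum_le_sum_of_subset_of_nonneg (subset_univ _)
          fun _ _ _ => mul_nonneg (sq_nonneg _) (w_nonneg H _ _)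
    _ = ∑ ξ, ∑ k ∈ Finset.range M, if (G.dist (p k) ξ ≤ r) then g ξ else 0 := Finset.sum_comm
    _ ≤ ∑ ξ, (2 * r + 1) * g ξ := by
        refine Finset.sum_le_sum fun ξ _ => ?_
        rw [← Finset.sum_filter, Finset.sum_const, nsmul_eq_mul]
        refine mul_le_mul_of_nonneg_right ?_ (hg0 ξ)
        have hsub : (Finset.range M).filter (fun k => G.dist (p k) ξ ≤ r) ⊆
            Finset.Icc (G.dist b ξ - r) (G.dist b ξ + r) := by
          intro k hk
          rw [Finset.mem_filter] at hk
          have h1 := hp k hk.1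
          have h2 := H.conn.dist_triangle (u := b) (v := p k) (w := ξ)
          have h3 := H.conn.dist_triangle (u := b) (v := ξ) (w := p k)
          rw [SimpleGraph.dist_comm (u := ξ)] at h3
          rw [Finset.mem_Icc]; omega
        have h4 := Finset.card_le_card hsub
        rw [Nat.card_Icc] at h4
        have h5 : ((Finset.range M).filter (fun k => G.dist (p k) ξ ≤ r)).card ≤ 2 * r + 1 := by omega
        exact_mod_cast h5
    _ = (2 * r + 1) * edf K pi u u := by
        rw [← Finset.mul_sum]
        congr 1
        unfold edf
        refine Finset.sum_congr rfl fun x _ => Finset.sum_congr rfl fun y _ => ?_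
        ring

lemma ballAvg_univ (H : HS G K pi θ α c1 c2 CD CP N D) (x : V) {r : ℝ} (hr : D ≤ r) (u : V → ℝ) :
    ballAvg G pi x r u = mean pi u := by
  unfold ballAvg mean
  rw [vol_univ H x hr, gball_univ H x hr, inv_one, one_mul]
  exact Finset.sum_congr rfl fun z _ => mul_comm _ _

lemma ballAvg_half (H : HS G K pi θ α c1 c2 CD CP N D) (x : V) (u : V → ℝ) :
    ballAvg G pi x (1 / 2) u = u x := by
  unfold ballAvg vol
  rw [gball_half H x]
  have := H.pi0 x
  simp; field_simp

lemma frost (H : HS G K pi θ α c1 c2 CD CP N D) (a b : V) {κ c0 : ℝ} (hκ0 : 0 ≤ κ)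
    (hκ1 : κ ≤ 1 / 2) (hκ : θ + κ ≤ α) (hc0 : 0 < c0) (hab : c0 * D ≤ G.dist b a) :
    mean pi (fun x => hit K x b) - hit K a b ≤
      24 * (CP * CD / c1) / (c0 * ((2 : ℝ) ^ ((1 - κ) / 2) - 1) ^ 2) * N * D ^ (-κ) := by
  have hD2 := H.D2
  have hD : 0 < D := by linarith
  have hCD := H.CDpos
  have hCP := H.CPpos
  have hc1 := H.c1pos
  have hN := H.Npos
  obtain ⟨J, hJ0, hJ⟩ := exists_J (D := D) (by linarith)
  set Ct := CP * CD / c1 with hCt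
  have hCt0 : 0 < Ct := by positivity
  set s := hit K a b with hs
  have hs0 : 0 ≤ s := hit_nonneg H a b
  set u : V → ℝ := fun x => max (hit K x b) s with hu
  set m := mean pi u with hm
  set M := G.dist b a + 1 with hM
  have hM0 : (0 : ℝ) < M := by positivity
  have hMD : c0 * D ≤ M := by rw [hM]; push_cast; linarith
  have hE : edf K pi u u ≤ 2 * (m - s) := by
    refine (edf_mono_contr H (fun x => hit K x b) u ?_).trans ?_
    · intro x y
      simp only [hu]
      rcases le_total (hit K x b) s with h1 | h1 <;> rcases le_total (hit K y b) s with h2 | h2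
      · rw [max_eq_right h1, max_eq_right h2]; simp
      · rw [max_eq_right h1, max_eq_left h2]; nlinarith
      · rw [max_eq_left h1, max_eq_right h2]; nlinarith
      · rw [max_eq_left h1, max_eq_left h2]; nlinarith
    · rw [edf_hit H]
      have : u b = s := by simp only [hu]; rw [hit_self, max_eq_right hs0]
      rw [this]
  have hE0 := edf_nonneg H u
  have hms : 0 ≤ m - s := by linarith
  have hp : ∀ k, ∃ x, k ∈ Finset.range M → G.dist b x = k ∧ hit K x b ≤ s := by
    intro k
    by_cases hk : k ∈ Finset.range M
    · obtain ⟨x, hx⟩ := exists_sphere H a b k (by rw [Finset.mem_range] at hk; omega)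
      exact ⟨x, fun _ => hx⟩
    · exact ⟨a, fun h => absurd h hk⟩
  choose p hp using hp
  set A : ℕ → ℕ → ℝ := fun j k => ballAvg G pi (p k) ((2 : ℝ) ^ j / 2) u with hA
  have hA0 : ∀ k ∈ Finset.range M, A 0 k = s := by
    intro k hk
    simp only [hA, pow_zero]
    rw [ballAvg_half H]
    simp only [hu]
    exact max_eq_right (hp k hk).2
  have hAJ : ∀ k, A (J + 1) k = m := by
    intro k
    simp only [hA]
    rw [ballAvg_univ H]
    rw [pow_succ]; linarith
  set e : ℕ → ℝ := fun j => (∑ k ∈ Finset.range M, (A (j + 1) k - A j k)) / M with he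
  have hsum : m - s = ∑ j ∈ Finset.range (J + 1), e j := by
    simp only [he]
    rw [← Finset.sum_div, Finset.sum_comm, eq_div_iff hM0.ne']
    have : ∀ k ∈ Finset.range M, ∑ j ∈ Finset.range (J + 1), (A (j + 1) k - A j k) = m - s := by
      intro k hk
      rw [Finset.sum_range_sub (fun j => A j k), hA0 k hk, hAJ k]
    rw [Finset.sum_congr rfl this]
    simp; ring
  set ρ : ℝ := (2 : ℝ) ^ ((1 - κ) / 2) with hρ
  have hρ0 : 0 < ρ := by positivity
  have hρ1 : 1 < ρ := Real.one_lt_rpow (by norm_num) (by linarith)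
  have hρ2 : ρ ^ 2 = (2 : ℝ) ^ (1 - κ) := by
    rw [hρ, ← Real.rpow_natCast, ← Real.rpow_mul (by norm_num)]; congr 1; push_cast; ring
  set Q := 3 * Ct * N * edf K pi u u / (c0 * D) with hQ
  have hQ0 : 0 ≤ Q := by positivity
  have hej : ∀ j ∈ Finset.range (J + 1), e j ≤ Real.sqrt Q * ρ ^ j := by
    intro j hj
    have hj2 : (2 : ℝ) ^ j ≤ 2 * D := le_trans (pow_le_pow_right₀ (by norm_num)
      (by rw [Finset.mem_range] at hj; omega)) hJ
    have hj1 : (1 : ℝ) ≤ 2 ^ j := one_le_pow₀ (by norm_num)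
    have h1 : (∑ k ∈ Finset.range M, (A (j + 1) k - A j k)) ^ 2 ≤
        M * ∑ k ∈ Finset.range M, (A (j + 1) k - A j k) ^ 2 := by
      have := sq_sum_le_card_mul_sum_sq (s := Finset.range M) (f := fun k => A (j + 1) k - A j k)
      simpa using this
    have h2 : ∑ k ∈ Finset.range M, (A (j + 1) k - A j k) ^ 2 ≤
        Ct * N * ((2 : ℝ) ^ j) ^ (θ - α) * ((2 * 2 ^ j + 1) * edf K pi u u) := by
      have h3 := count_energy H b M p (fun k hk => (hp k hk).1) (2 ^ j) u
      push_cast at h3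
      calc _ ≤ ∑ k ∈ Finset.range M, Ct * N * ((2 : ℝ) ^ j) ^ (θ - α) *
            eball G K pi (p k) (2 ^ j) u := by
            refine Finset.sum_le_sum fun k _ => ?_
            have := ballstep H (p k) hj1 hj2 u
            simp only [hA]
            rw [show (2 : ℝ) ^ (j + 1) / 2 = 2 ^ j by rw [pow_succ]; ring]
            exact this
        _ ≤ _ := by
            rw [← Finset.mul_sum]
            exact mul_le_mul_of_nonneg_left h3 (by positivity)
    have h4 : ((2 : ℝ) ^ j) ^ (θ - α) * 2 ^ j ≤ (ρ ^ j) ^ 2 := by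
      rw [← pow_mul, mul_comm j 2, pow_mul, hρ2]
      have e1 : ((2 : ℝ) ^ j) ^ (θ - α) * 2 ^ j = ((2 : ℝ) ^ j) ^ (θ - α + 1) := by
        rw [Real.rpow_add_one (by positivity)]
      have e2 : ((2 : ℝ) ^ (1 - κ)) ^ j = ((2 : ℝ) ^ j) ^ (1 - κ) := by
        rw [← Real.rpow_natCast, ← Real.rpow_natCast, ← Real.rpow_mul (by norm_num),
          ← Real.rpow_mul (by norm_num), mul_comm]
      rw [e1, e2]
      exact Real.rpow_le_rpow_of_exponent_le hj1 (by linarith)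
    have h5 : (e j) ^ 2 ≤ Q * (ρ ^ j) ^ 2 := by
      have e3 : (e j) ^ 2 = (∑ k ∈ Finset.range M, (A (j + 1) k - A j k)) ^ 2 / M ^ 2 := by
        simp only [he]; rw [div_pow]
      rw [e3, div_le_iff₀ (by positivity)]
      refine h1.trans ?_
      have h6 : ∑ k ∈ Finset.range M, (A (j + 1) k - A j k) ^ 2 ≤
          3 * Ct * N * edf K pi u u * (ρ ^ j) ^ 2 := by
        refine h2.trans ?_
        calc Ct * N * ((2 : ℝ) ^ j) ^ (θ - α) * ((2 * 2 ^ j + 1) * edf K pi u u)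
            ≤ Ct * N * ((2 : ℝ) ^ j) ^ (θ - α) * ((3 * 2 ^ j) * edf K pi u u) := by
              refine mul_le_mul_of_nonneg_left ?_ (by positivity)
              refine mul_le_mul_of_nonneg_right ?_ hE0
              linarith
          _ = 3 * Ct * N * edf K pi u u * (((2 : ℝ) ^ j) ^ (θ - α) * 2 ^ j) := by ring
          _ ≤ _ := mul_le_mul_of_nonneg_left h4 (by positivity)
      have h7 : 3 * Ct * N * edf K pi u u = Q * (c0 * D) := by rw [hQ]; field_simp
      rw [h7] at h6
      calc M * ∑ k ∈ Finset.range M, (A (j + 1) k - A j k) ^ 2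
          ≤ M * (Q * (c0 * D) * (ρ ^ j) ^ 2) := by gcongr
        _ ≤ M * (Q * M * (ρ ^ j) ^ 2) := by gcongr
        _ = _ := by ring
    have h8 : e j ≤ Real.sqrt (Q * (ρ ^ j) ^ 2) := Real.le_sqrt_of_sq_le h5
    rwa [Real.sqrt_mul hQ0, Real.sqrt_sq (by positivity)] at h8
  have hgeo : ∑ j ∈ Finset.range (J + 1), ρ ^ j ≤ ρ ^ (J + 1) / (ρ - 1) := by
    rw [geom_sum_eq hρ1.ne']
    gcongr
    linarith
  have h9 : m - s ≤ Real.sqrt Q * (ρ ^ (J + 1) / (ρ - 1)) := by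
    rw [hsum]
    refine (Finset.sum_le_sum hej).trans ?_
    rw [← Finset.mul_sum]
    exact mul_le_mul_of_nonneg_left hgeo (Real.sqrt_nonneg _)
  have h10 : (m - s) ^ 2 ≤ Q * ((ρ ^ (J + 1)) ^ 2 / (ρ - 1) ^ 2) := by
    have := pow_le_pow_left₀ hms h9 2
    rwa [mul_pow, Real.sq_sqrt hQ0, div_pow] at this
  have h11 : (ρ ^ (J + 1)) ^ 2 ≤ 4 * D ^ (1 - κ) := by
    rw [← pow_mul, mul_comm (J + 1) 2, pow_mul, hρ2]
    have e2 : ((2 : ℝ) ^ (1 - κ)) ^ (J + 1) = ((2 : ℝ) ^ (J + 1)) ^ (1 - κ) := by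
      rw [← Real.rpow_natCast, ← Real.rpow_natCast, ← Real.rpow_mul (by norm_num),
        ← Real.rpow_mul (by norm_num), mul_comm]
    rw [e2]
    calc ((2 : ℝ) ^ (J + 1)) ^ (1 - κ) ≤ (4 * D) ^ (1 - κ) := by
          apply Real.rpow_le_rpow (by positivity) _ (by linarith)
          rw [pow_succ]; linarith
      _ = 4 ^ (1 - κ) * D ^ (1 - κ) := Real.mul_rpow (by norm_num) hD.le
      _ ≤ 4 ^ (1 : ℝ) * D ^ (1 - κ) := by
          gcongr
          · norm_num
          · linarith
      _ = _ := by rw [Real.rpow_one]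
  have hρ3 : 0 < (ρ - 1) ^ 2 := by have : 0 < ρ - 1 := by linarith
                                   positivity
  have h12 : (m - s) * (m - s) ≤ (24 * Ct / (c0 * (ρ - 1) ^ 2) * N * D ^ (-κ)) * (m - s) := by
    calc (m - s) * (m - s) = (m - s) ^ 2 := by ring
      _ ≤ Q * ((ρ ^ (J + 1)) ^ 2 / (ρ - 1) ^ 2) := h10
      _ ≤ Q * ((4 * D ^ (1 - κ)) / (ρ - 1) ^ 2) := by gcongr
      _ = edf K pi u u * (12 * Ct / (c0 * (ρ - 1) ^ 2) * N * D ^ (-κ)) := by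
          rw [hQ, show (1 - κ) = -κ + 1 by ring, Real.rpow_add_one hD.ne']
          field_simp; ring
      _ ≤ (2 * (m - s)) * (12 * Ct / (c0 * (ρ - 1) ^ 2) * N * D ^ (-κ)) := by
          apply mul_le_mul_of_nonneg_right hE
          positivity
      _ = _ := by ring
  have hmm : mean pi (fun x => hit K x b) ≤ m := by
    refine Finset.sum_le_sum fun x _ => ?_
    exact mul_le_mul_of_nonneg_left (le_max_left _ _) (H.pi0 x).le
  have h13 : m - s ≤ 24 * Ct / (c0 * (ρ - 1) ^ 2) * N * D ^ (-κ) := by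
    rcases hms.eq_or_lt with h | h
    · rw [← h]; positivity
    · exact le_of_mul_le_mul_right h12 h
  linarith

end frostman

section recurrent

variable {G : SimpleGraph V} {K : V → V → ℝ} {pi : V → ℝ} {θ α c1 c2 CD CP N D : ℝ}

lemma edf_comm (f g : V → ℝ) : edf K pi f g = edf K pi g f := by
  unfold edf
  refine Finset.sum_congr rfl fun x _ => Finset.sum_congr rfl fun y _ => ?_
  ring

lemma const_of_edf_zero (H : HS G K pi θ α c1 c2 CD CP N D) (u : V → ℝ)
    (h : edf K pi u u ≤ 0) (x y : V) : u x = u y := by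
  have hD := H.D2
  have h1 := pi_ball H x D (by linarith) u
  have hCP := H.CPpos
  have hDθ : 0 < D ^ θ := Real.rpow_pos_of_pos (by linarith) _
  have h2 : CP * D ^ θ * eball G K pi x D u ≤ 0 :=
    mul_nonpos_of_nonneg_of_nonpos (by positivity) ((eball_le_edf H x D u).trans h)
  rw [gball_univ H x le_rfl] at h1
  have h3 : ∀ z, u z = ballAvg G pi x D u := by
    intro z
    have h4 : (u z - ballAvg G pi x D u) ^ 2 * pi z ≤
        ∑ z, (u z - ballAvg G pi x D u) ^ 2 * pi z :=
      Finset.single_le_sum (f := fun z => (u z - ballAvg G pi x D u) ^ 2 * pi z)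
        (fun z _ => mul_nonneg (sq_nonneg _) (H.pi0 z).le) (mem_univ z)
    have h5 : (u z - ballAvg G pi x D u) ^ 2 * pi z ≤ 0 := by linarith
    have h6 : (u z - ballAvg G pi x D u) ^ 2 ≤ 0 := by
      by_contra hc
      push Not at hc
      have := mul_pos hc (H.pi0 z)
      linarith
    have h7 : u z - ballAvg G pi x D u = 0 := by
      have := le_antisymm h6 (sq_nonneg _)
      exact pow_eq_zero_iff (two_ne_zero) |>.1 this
    linarith
  rw [h3 x, h3 y]

set_option maxHeartbeats 2000000 in
lemma sr_lower (H : HS G K pi θ α c1 c2 CD CP N D) {C1 C2 ε : ℝ} (hC2 : 0 < C2)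
    (CS : CondCS G K pi θ C1 C2 ε) (hαθ : α < θ) (hα : 0 < α) (a b : V) {c0 δ Cσ q : ℝ}
    (hc0 : 0 < c0) (hCσ : Cσ = 2 * C2 * c2 * 2 ^ α) (hq : q = (2 : ℝ) ^ (θ - α))
    (hab : c0 * D ≤ G.dist a b) (hδ0 : 0 < δ) (hδ1 : δ ≤ 1)
    (hδ : 25 * CP * CD / c1 * (q / (q - 1)) * Cσ * δ ^ (θ - α) ≤ (c0 / 2) ^ (θ - α))
    (h1 : 1 ≤ δ * D) (h2 : 1 ≤ c0 / 2 * D) :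
    1 / 3 * c1 * (2 / Cσ) * (δ / 2) ^ α * (c0 / 2) ^ (θ - α) * D ^ θ ≤ hit K a b := by
  have hD2 := H.D2
  have hD : 0 < D := by linarith
  have hCD := H.CDpos
  have hCP := H.CPpos
  have hc1 := H.c1pos
  have hc2 := H.c2pos
  have hN := H.Npos
  have hCσ0 : 0 < Cσ := by rw [hCσ]; positivity
  have hq1 : 1 < q := by rw [hq]; exact Real.one_lt_rpow (by norm_num) (by linarith)
  set φ : V → ℝ := fun z => hit K z b - hit K z a + hit K b a with hφ
  have hφb : φ b = 0 := by simp only [hφ]; rw [hit_self]; ring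
  set R := φ a with hR
  have hed : ∀ g, edf K pi φ g = 2 * (g a - g b) := by
    intro g
    have e1 := edf_hit H b g
    have e2 := edf_hit H a g
    have e3 : edf K pi φ g = edf K pi (fun x => hit K x b) g - edf K pi (fun x => hit K x a) g := by
      unfold edf
      rw [← Finset.sum_sub_distrib]
      refine Finset.sum_congr rfl fun x _ => ?_
      rw [← Finset.sum_sub_distrib]
      refine Finset.sum_congr rfl fun y _ => ?_
      simp only [hφ]; ring
    rw [e3, e1, e2]; ring
  have hER : edf K pi φ φ = 2 * R := by rw [hed, hφb]; ring
  have hR0 : 0 ≤ R := by have := edf_nonneg H φ; linarith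
  have hmean : mean pi φ = hit K a b := by
    have e1 := edf_hit H b (fun x => hit K x a)
    have e2 := edf_hit H a (fun x => hit K x b)
    rw [edf_comm, e2] at e1
    have e3 : mean pi φ = mean pi (fun x => hit K x b) - mean pi (fun x => hit K x a) + hit K b a := by
      unfold mean
      have : hit K b a = ∑ x, pi x * hit K b a := by rw [← Finset.sum_mul, H.pi1, one_mul]
      conv_rhs => rw [this]
      rw [← Finset.sum_sub_distrib, ← Finset.sum_add_distrib]
      exact Finset.sum_congr rfl fun x _ => by simp only [hφ]; ring
    rw [e3]; linarith
  have hφ0 : ∀ z, 0 ≤ φ z := by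
    intro z
    set u : V → ℝ := fun x => min (φ x) 0 with hu
    have h3 : edf K pi u u ≤ 0 := by
      refine (edf_mono_contr H φ u ?_).trans ?_
      · intro x y
        simp only [hu]
        rcases le_total (φ x) 0 with h1 | h1 <;> rcases le_total (φ y) 0 with h2 | h2
        · rw [min_eq_left h1, min_eq_left h2]; nlinarith
        · rw [min_eq_left h1, min_eq_right h2]; nlinarith
        · rw [min_eq_right h1, min_eq_left h2]; nlinarith
        · rw [min_eq_right h1, min_eq_right h2]; simp
      · rw [hed]; simp only [hu]; rw [hφb, min_eq_right (show (0:ℝ) ≤ φ a from hR0)]; simp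
    have h4 := const_of_edf_zero H u h3 z b
    simp only [hu, hφb, min_self] at h4
    exact min_eq_right_iff.1 h4
  have hcl : Clampy K pi φ := by
    intro s t ht
    refine (edf_mono_contr H φ _ (fun x y => clamp_contr _ _ _ _)).trans ?_
    rw [hed]
    have h1 : max s (min (φ a) (s + t)) ≤ s + t := max_le (by linarith) (min_le_right _ _)
    have h2 := le_max_left s (min (φ b) (s + t))
    linarith
  -- lower bound on the resistance
  set X := (c0 / 2 * D) ^ (θ - α) with hX
  have hX0 : 0 < X := by positivity
  have hRlow : 2 / Cσ * N * X ≤ R := by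
    obtain ⟨σ, s1, s2, s3, s4⟩ := cutoff H hC2 CS a h2
    have e1 := edf_cs H φ σ
    rw [hed, hER, s1 a (self_mem_gball (by linarith)), s2 b (by
      rw [mem_gball]; push Not
      have : 0 < c0 * D := by positivity
      linarith)] at e1
    rw [← hCσ] at s4
    have e2 : (c0 / 2 * D) ^ (α - θ) = X⁻¹ := by
      rw [hX, ← Real.rpow_neg (by positivity)]; congr 1; ring
    rw [e2] at s4
    have e3 : (4 : ℝ) ≤ 2 * R * (Cσ / N * X⁻¹) := by
      have := mul_le_mul_of_nonneg_left s4 (show 0 ≤ 2 * R by linarith)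
      linarith
    have e4 : 2 * R * (Cσ / N * X⁻¹) = 2 * (R * Cσ) / (N * X) := by field_simp
    rw [e4, le_div_iff₀ (by positivity)] at e3
    have e5 : 2 / Cσ * N * X = 2 * (N * X) / Cσ := by ring
    rw [e5, div_le_iff₀ hCσ0]
    linarith
  obtain ⟨J, hJ1, hJ2⟩ := exists_nat_pow_near (x := δ * D) (y := (2 : ℝ)) h1 (by norm_num)
  have hJD : (2 : ℝ) ^ J ≤ 2 * D := by nlinarith
  have hch := chain H hcl.neg a J hJD
  have hT : Tsum θ α c1 CD CP N (J + 1) ≤ R / 2 := by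
    refine le_trans ?_ (show 1 / Cσ * N * X ≤ R / 2 by
      have : 1 / Cσ * N * X = (2 / Cσ * N * X) / 2 := by ring
      linarith)
    unfold Tsum
    rw [← hq]
    have hg : ∑ i ∈ Finset.range (J + 1), q ^ i ≤ q / (q - 1) * (δ * D) ^ (θ - α) := by
      rw [geom_sum_eq hq1.ne']
      have hq0 : 0 < q - 1 := by linarith
      have e1 : q ^ J ≤ (δ * D) ^ (θ - α) := by
        have : q ^ J = ((2 : ℝ) ^ J) ^ (θ - α) := by
          rw [hq, ← Real.rpow_natCast, ← Real.rpow_natCast, ← Real.rpow_mul (by norm_num),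
            ← Real.rpow_mul (by norm_num), mul_comm]
        rw [this]
        exact Real.rpow_le_rpow (by positivity) hJ1 (by linarith)
      rw [div_mul_eq_mul_div, pow_succ]
      gcongr
      nlinarith
    calc 25 * CP * CD / c1 * N * ∑ i ∈ Finset.range (J + 1), q ^ i
        ≤ 25 * CP * CD / c1 * N * (q / (q - 1) * (δ * D) ^ (θ - α)) := by gcongr
      _ = (25 * CP * CD / c1 * (q / (q - 1)) * Cσ * δ ^ (θ - α)) * (N * D ^ (θ - α) / Cσ) := by
          rw [Real.mul_rpow hδ0.le hD.le]; field_simp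
      _ ≤ (c0 / 2) ^ (θ - α) * (N * D ^ (θ - α) / Cσ) := by gcongr
      _ = _ := by rw [hX, Real.mul_rpow (by positivity) hD.le]; ring
  have hlow : 1 / 3 * vol G pi a (2 ^ J) * R ≤ mean pi φ := by
    set S := (gball G a ((2 : ℝ) ^ J)).filter
      (fun z => -φ z ≤ -φ a + Tsum θ α c1 CD CP N (J + 1))
    calc 1 / 3 * vol G pi a (2 ^ J) * R = (2 / 3 * vol G pi a (2 ^ J)) * (R / 2) := by ring
      _ ≤ (∑ z ∈ S, pi z) * (R / 2) := mul_le_mul_of_nonneg_right hch (by linarith)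
      _ ≤ ∑ z ∈ S, pi z * φ z := by
          rw [Finset.sum_mul]
          refine Finset.sum_le_sum fun z hz => ?_
          refine mul_le_mul_of_nonneg_left ?_ (H.pi0 z).le
          have := (Finset.mem_filter.1 hz).2
          change _ ≤ -R + _ at this
          linarith
      _ ≤ _ := Finset.sum_le_sum_of_subset_of_nonneg (subset_univ _)
          (fun z _ _ => mul_nonneg (H.pi0 z).le (hφ0 z))
  rw [hmean] at hlow
  refine le_trans ?_ hlow
  have hv := H.vlow a (2 ^ J) (one_le_pow₀ (by norm_num)) hJD
  have hv2 : c1 * (δ / 2) ^ α * D ^ α ≤ N * vol G pi a (2 ^ J) := by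
    refine le_trans ?_ hv
    rw [mul_assoc, ← Real.mul_rpow (by positivity) hD.le]
    gcongr
    rw [pow_succ] at hJ2
    linarith
  have hvp := vol_pos H a (r := 2 ^ J) (by positivity)
  calc 1 / 3 * c1 * (2 / Cσ) * (δ / 2) ^ α * (c0 / 2) ^ (θ - α) * D ^ θ
      = 1 / 3 * (2 / Cσ) * (c1 * (δ / 2) ^ α * D ^ α) * X := by
        rw [hX, Real.mul_rpow (by positivity) hD.le, show D ^ θ = D ^ α * D ^ (θ - α) by
          rw [← Real.rpow_add hD]; congr 1; ring]
        ring
    _ ≤ 1 / 3 * (2 / Cσ) * (N * vol G pi a (2 ^ J)) * X := by gcongr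
    _ = 1 / 3 * vol G pi a (2 ^ J) * (2 / Cσ * N * X) := by ring
    _ ≤ _ := by gcongr

end recurrent

section cases

lemma ne_of_far {V : Type} [Fintype V] [DecidableEq V] {G : SimpleGraph V} {D c0 : ℝ} {a b : V}
    (hD : 0 < D) (hc0 : 0 < c0) (hab : c0 * D ≤ G.dist a b) : a ≠ b := by
  rintro rfl
  have : 0 < c0 * D := by positivity
  simp at hab
  linarith

lemma case_gt (θ α c0 c1 c2 CD CP C1 C2 ε : ℝ) (hα : 0 < α) (h : θ < α) (hc0 : 0 < c0)
    (hc1 : 0 < c1) (hc2 : 0 < c2) (hCD : 0 < CD) (hCP : 0 < CP) (hC2 : 0 < C2) :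
    ∃ c > (0 : ℝ), ∃ C > (0 : ℝ), ∀ (V : Type) [Fintype V] [DecidableEq V],
      ∀ (G : SimpleGraph V) (K : V → V → ℝ) (pi : V → ℝ) (N D : ℝ),
        HS G K pi θ α c1 c2 CD CP N D → CondCS G K pi θ C1 C2 ε →
        ∀ a b : V, c0 * D ≤ G.dist a b → c * D ^ α ≤ hit K a b ∧ hit K a b ≤ C * D ^ α := by
  obtain ⟨q, hq⟩ : ∃ q, q = (2 : ℝ) ^ (θ - α) := ⟨_, rfl⟩
  have hq0 : 0 < q := by rw [hq]; positivity
  have hq1 : q < 1 := by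
    rw [hq]; exact Real.rpow_lt_one_of_one_lt_of_neg (by norm_num) (by linarith)
  obtain ⟨κ, hκ⟩ : ∃ κ, κ = min (α - θ) (1 / 2) := ⟨_, rfl⟩
  have hκ0 : 0 < κ := by rw [hκ]; exact lt_min (by linarith) (by norm_num)
  have hκ1 : κ ≤ 1 / 2 := by rw [hκ]; exact min_le_right _ _
  have hκ2 : θ + κ ≤ α := by
    have : κ ≤ α - θ := by rw [hκ]; exact min_le_left _ _
    linarith
  obtain ⟨Cm, hCm⟩ : ∃ Cm, Cm = 4 * C2 * c2 * 2 ^ α := ⟨_, rfl⟩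
  have hCm0 : 0 < Cm := by rw [hCm]; positivity
  obtain ⟨F, hF⟩ : ∃ F, F = 24 * (CP * CD / c1) / (c0 * ((2 : ℝ) ^ ((1 - κ) / 2) - 1) ^ 2) :=
    ⟨_, rfl⟩
  have ev1 : ∀ᶠ D : ℝ in Filter.atTop, 2 * c2 / c1 ≤ D ^ α :=
    (tendsto_rpow_atTop hα).eventually_ge_atTop _
  have ev2 : ∀ᶠ D : ℝ in Filter.atTop, F * D ^ (-κ) ≤ 1 / (2 * Cm) := by
    have := (tendsto_rpow_neg_atTop hκ0).const_mul F
    rw [mul_zero] at this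
    exact this.eventually_le_const (by positivity)
  obtain ⟨D0, hD0⟩ := Filter.eventually_atTop.1 (ev1.and ev2)
  obtain ⟨D1, hD1⟩ : ∃ D1, D1 = max D0 1 := ⟨_, rfl⟩
  have hD10 : D0 ≤ D1 := by rw [hD1]; exact le_max_left _ _
  have hD11 : 1 ≤ D1 := by rw [hD1]; exact le_max_right _ _
  have hD1p : 0 < D1 ^ α := Real.rpow_pos_of_pos (by linarith) _
  refine ⟨min (c1 / (2 * Cm)) (1 / D1 ^ α), lt_min (by positivity) (by positivity),
    2 * (25 * CP * CD / c1 * c2 * (1 / (1 - q))), ?_, ?_⟩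
  · have : 0 < 1 - q := by linarith
    positivity
  intro V _ _ G K pi N D H CS a b hab
  have hD2 := H.D2
  have hD : 0 < D := by linarith
  have hDα : 0 < D ^ α := Real.rpow_pos_of_pos hD _
  have hN := H.Npos
  obtain ⟨hNl, hNu⟩ := N_bounds H a
  constructor
  · rcases le_total D1 D with hl | hl
    · obtain ⟨e1, e2⟩ := hD0 D (by linarith)
      have e3 : 2 * c2 ≤ N := by
        rw [div_le_iff₀ hc1] at e1
        linarith
      have e4 := mean_lower_gt H hC2 CS b e3
      have e5 := frost H a b hκ0.le hκ1 hκ2 hc0 (by rw [G.dist_comm]; exact hab)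
      rw [← hCm] at e4
      rw [← hF] at e5
      rw [← div_le_iff₀ hCm0] at e4
      have e6 : F * N * D ^ (-κ) ≤ N * (1 / (2 * Cm)) := by
        have := mul_le_mul_of_nonneg_left e2 hN.le
        linarith
      have e7 : N / Cm = 2 * (N * (1 / (2 * Cm))) := by field_simp
      have e8 : N * (1 / (2 * Cm)) ≤ hit K a b := by linarith
      refine le_trans ?_ e8
      calc min (c1 / (2 * Cm)) (1 / D1 ^ α) * D ^ α ≤ c1 / (2 * Cm) * D ^ α := by
            gcongr; exact min_le_left _ _
        _ = c1 * D ^ α * (1 / (2 * Cm)) := by ring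
        _ ≤ _ := by gcongr
    · refine le_trans ?_ (one_le_hit H (ne_of_far hD hc0 hab))
      calc min (c1 / (2 * Cm)) (1 / D1 ^ α) * D ^ α ≤ 1 / D1 ^ α * D1 ^ α := by
            gcongr; exact min_le_right _ _
        _ = 1 := by field_simp
  · obtain ⟨J, hJ1, hJ2⟩ := exists_J (D := D) (by linarith)
    refine (hit_upper H a b J hJ1 hJ2).trans ?_
    unfold Tsum
    rw [← hq, geom_sum_eq hq1.ne]
    have e1 : (q ^ (J + 1) - 1) / (q - 1) ≤ 1 / (1 - q) := by
      rw [← neg_div_neg_eq, neg_sub, neg_sub]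
      have : 0 < 1 - q := by linarith
      gcongr
      have := pow_pos hq0 (J + 1)
      linarith
    calc 2 * (25 * CP * CD / c1 * N * ((q ^ (J + 1) - 1) / (q - 1)))
        ≤ 2 * (25 * CP * CD / c1 * N * (1 / (1 - q))) := by gcongr
      _ ≤ 2 * (25 * CP * CD / c1 * (c2 * D ^ α) * (1 / (1 - q))) := by
          have : 0 < 1 - q := by linarith
          gcongr
      _ = _ := by ring

lemma case_lt (θ α c0 c1 c2 CD CP C1 C2 ε : ℝ) (hα : 0 < α) (h : α < θ) (hc0 : 0 < c0)
    (hc1 : 0 < c1) (hc2 : 0 < c2) (hCD : 0 < CD) (hCP : 0 < CP) (hC2 : 0 < C2) :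
    ∃ c > (0 : ℝ), ∃ C > (0 : ℝ), ∀ (V : Type) [Fintype V] [DecidableEq V],
      ∀ (G : SimpleGraph V) (K : V → V → ℝ) (pi : V → ℝ) (N D : ℝ),
        HS G K pi θ α c1 c2 CD CP N D → CondCS G K pi θ C1 C2 ε →
        ∀ a b : V, c0 * D ≤ G.dist a b → c * D ^ θ ≤ hit K a b ∧ hit K a b ≤ C * D ^ θ := by
  have hθ : 0 < θ := by linarith
  have hs : 0 < θ - α := by linarith
  obtain ⟨q, hq⟩ : ∃ q, q = (2 : ℝ) ^ (θ - α) := ⟨_, rfl⟩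
  have hq1 : 1 < q := by rw [hq]; exact Real.one_lt_rpow (by norm_num) (by linarith)
  have hq0 : 0 < q - 1 := by linarith
  obtain ⟨Cσ, hCσ⟩ : ∃ Cσ, Cσ = 2 * C2 * c2 * 2 ^ α := ⟨_, rfl⟩
  have hCσ0 : 0 < Cσ := by rw [hCσ]; positivity
  obtain ⟨A, hA⟩ : ∃ A, A = 25 * CP * CD / c1 * (q / (q - 1)) * Cσ := ⟨_, rfl⟩
  have hA0 : 0 < A := by rw [hA]; positivity
  obtain ⟨Y, hY⟩ : ∃ Y, Y = (c0 / 2) ^ (θ - α) / A := ⟨_, rfl⟩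
  have hY0 : 0 < Y := by rw [hY]; positivity
  obtain ⟨δ, hδ⟩ : ∃ δ, δ = min 1 (Y ^ (θ - α)⁻¹) := ⟨_, rfl⟩
  have hδ0 : 0 < δ := by rw [hδ]; exact lt_min one_pos (by positivity)
  have hδ1 : δ ≤ 1 := by rw [hδ]; exact min_le_left _ _
  have hδA : A * δ ^ (θ - α) ≤ (c0 / 2) ^ (θ - α) := by
    have h1 : δ ≤ Y ^ (θ - α)⁻¹ := by rw [hδ]; exact min_le_right _ _
    have h2 : δ ^ (θ - α) ≤ Y := by
      calc δ ^ (θ - α) ≤ (Y ^ (θ - α)⁻¹) ^ (θ - α) := Real.rpow_le_rpow hδ0.le h1 hs.le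
        _ = Y := by rw [← Real.rpow_mul hY0.le, inv_mul_cancel₀ hs.ne', Real.rpow_one]
    rw [hY, le_div_iff₀ hA0] at h2
    linarith
  obtain ⟨D1, hD1⟩ : ∃ D1, D1 = max (1 / δ) (2 / c0) := ⟨_, rfl⟩
  have hD10 : 1 / δ ≤ D1 := by rw [hD1]; exact le_max_left _ _
  have hD11 : 2 / c0 ≤ D1 := by rw [hD1]; exact le_max_right _ _
  have hD1p : 0 < D1 := lt_of_lt_of_le (by positivity) hD10
  refine ⟨min (1 / 3 * c1 * (2 / Cσ) * (δ / 2) ^ α * (c0 / 2) ^ (θ - α)) (1 / D1 ^ θ),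
    lt_min (by positivity) (by positivity),
    2 * (25 * CP * CD / c1 * c2 * (q / (q - 1) * 2 ^ (θ - α))), by positivity, ?_⟩
  intro V _ _ G K pi N D H CS a b hab
  have hD2 := H.D2
  have hD : 0 < D := by linarith
  have hN := H.Npos
  obtain ⟨hNl, hNu⟩ := N_bounds H a
  constructor
  · rcases le_total D1 D with hl | hl
    · have e1 : 1 ≤ δ * D := by
        have := hD10.trans hl
        rw [div_le_iff₀ hδ0] at this
        linarith
      have e2 : 1 ≤ c0 / 2 * D := by
        have := hD11.trans hl
        rw [div_le_iff₀ hc0] at this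
        linarith
      refine le_trans ?_ (sr_lower H hC2 CS h hα a b hc0 hCσ hq hab hδ0 hδ1
        (by rw [← hA]; exact hδA) e1 e2)
      gcongr
      exact min_le_left _ _
    · refine le_trans ?_ (one_le_hit H (ne_of_far hD hc0 hab))
      calc min (1 / 3 * c1 * (2 / Cσ) * (δ / 2) ^ α * (c0 / 2) ^ (θ - α)) (1 / D1 ^ θ) * D ^ θ
          ≤ 1 / D1 ^ θ * D1 ^ θ := by
            gcongr; exact min_le_right _ _
        _ = 1 := by field_simp
  · obtain ⟨J, hJ1, hJ2⟩ := exists_J (D := D) (by linarith)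
    refine (hit_upper H a b J hJ1 hJ2).trans ?_
    unfold Tsum
    rw [← hq, geom_sum_eq hq1.ne']
    have e0 : q ^ J ≤ (2 * D) ^ (θ - α) := by
      have : q ^ J = ((2 : ℝ) ^ J) ^ (θ - α) := by
        rw [hq, ← Real.rpow_natCast, ← Real.rpow_natCast, ← Real.rpow_mul (by norm_num),
          ← Real.rpow_mul (by norm_num), mul_comm]
      rw [this]
      exact Real.rpow_le_rpow (by positivity) hJ2 (by linarith)
    have e1 : (q ^ (J + 1) - 1) / (q - 1) ≤ q / (q - 1) * (2 * D) ^ (θ - α) := by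
      rw [div_mul_eq_mul_div, pow_succ]
      gcongr
      nlinarith
    have e2 : D ^ θ = D ^ α * D ^ (θ - α) := by
      rw [← Real.rpow_add hD]; congr 1; ring
    calc 2 * (25 * CP * CD / c1 * N * ((q ^ (J + 1) - 1) / (q - 1)))
        ≤ 2 * (25 * CP * CD / c1 * (c2 * D ^ α) * (q / (q - 1) * (2 * D) ^ (θ - α))) := by
          have : 0 ≤ (q ^ (J + 1) - 1) / (q - 1) :=
            div_nonneg (by linarith [one_le_pow₀ hq1.le (n := J + 1)]) hq0.le
          gcongr
      _ = _ := by rw [e2, Real.mul_rpow (by norm_num) hD.le, ← hq]; ring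

lemma case_eq (θ α c0 c1 c2 CD CP C1 C2 ε : ℝ) (hα : 0 < α) (h : α = θ) (hc0 : 0 < c0)
    (hc1 : 0 < c1) (hc2 : 0 < c2) (hCD : 0 < CD) (hCP : 0 < CP) (hC2 : 0 < C2) :
    ∃ c > (0 : ℝ), ∃ C > (0 : ℝ), ∀ (V : Type) [Fintype V] [DecidableEq V],
      ∀ (G : SimpleGraph V) (K : V → V → ℝ) (pi : V → ℝ) (N D : ℝ),
        HS G K pi θ α c1 c2 CD CP N D → CondCS G K pi θ C1 C2 ε →
        ∀ a b : V, c0 * D ≤ G.dist a b →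
          c * (D ^ θ * Real.log D) ≤ hit K a b ∧ hit K a b ≤ C * (D ^ θ * Real.log D) := by
  have hl2 : 0 < Real.log 2 := Real.log_pos (by norm_num)
  have hl8 : 0 < Real.log 8 := Real.log_pos (by norm_num)
  obtain ⟨Cm, hCm⟩ : ∃ Cm, Cm = 4 * C2 * c2 * 2 ^ α := ⟨_, rfl⟩
  have hCm0 : 0 < Cm := by rw [hCm]; positivity
  obtain ⟨F, hF⟩ : ∃ F, F = 24 * (CP * CD / c1) / (c0 * ((2 : ℝ) ^ ((1 - (0 : ℝ)) / 2) - 1) ^ 2) :=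
    ⟨_, rfl⟩
  obtain ⟨Y, hY⟩ : ∃ Y, Y = c1 / (2 * c2) := ⟨_, rfl⟩
  have hY0 : 0 < Y := by rw [hY]; positivity
  obtain ⟨δ, hδ⟩ : ∃ δ, δ = Y ^ α⁻¹ := ⟨_, rfl⟩
  have hδ0 : 0 < δ := by rw [hδ]; positivity
  have hδA : 2 * c2 * δ ^ α = c1 := by
    rw [hδ, ← Real.rpow_mul hY0.le, inv_mul_cancel₀ hα.ne', Real.rpow_one, hY]
    field_simp
  have ev : ∀ᶠ D : ℝ in Filter.atTop,
      max (2 * (Real.log 8 - Real.log δ)) (max (4 * Real.log 8) (4 * Real.log 8 * Cm * F))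
        ≤ Real.log D :=
    Real.tendsto_log_atTop.eventually_ge_atTop _
  have ev2 : ∀ᶠ D : ℝ in Filter.atTop, 8 / δ ≤ D := Filter.eventually_ge_atTop _
  obtain ⟨D0, hD0⟩ := Filter.eventually_atTop.1 (ev.and ev2)
  obtain ⟨D1, hD1⟩ : ∃ D1, D1 = max D0 2 := ⟨_, rfl⟩
  have hD10 : D0 ≤ D1 := by rw [hD1]; exact le_max_left _ _
  have hD11 : 2 ≤ D1 := by rw [hD1]; exact le_max_right _ _
  have hD1p : 0 < D1 := by linarith
  have hD1l : 0 < Real.log D1 := Real.log_pos (by linarith)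
  refine ⟨min (c1 / (4 * Real.log 8 * Cm)) (1 / (D1 ^ θ * Real.log D1)),
    lt_min (by positivity) (by positivity),
    2 * (25 * CP * CD / c1 * c2 * (3 / Real.log 2)), by positivity, ?_⟩
  intro V _ _ G K pi N D H CS a b hab
  have hD2 := H.D2
  have hD : 0 < D := by linarith
  have hN := H.Npos
  have hDl : 0 < Real.log D := Real.log_pos (by linarith)
  obtain ⟨hNl, hNu⟩ := N_bounds H a
  constructor
  · rcases le_total D1 D with hl | hl
    · obtain ⟨e0, e1⟩ := hD0 D (by linarith)
      have m1 := (le_max_left _ _).trans e0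
      have m2 := ((le_max_left _ _).trans (le_max_right _ _)).trans e0
      have m3 := ((le_max_right _ _).trans (le_max_right _ _)).trans e0
      rw [div_le_iff₀ hδ0] at e1
      obtain ⟨k, hk1, hk2⟩ := exists_nat_pow_near (x := δ * D) (y := (8 : ℝ)) (by linarith)
        (by norm_num)
      have hkl : Real.log D / (2 * Real.log 8) ≤ k := by
        have h1 := Real.log_le_log (by positivity) hk2.le
        rw [Real.log_mul hδ0.ne' hD.ne', Real.log_pow] at h1
        push_cast at h1
        rw [div_le_iff₀ (by positivity)]
        linarith
      have hk0 : 0 < k := by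
        have : 0 < Real.log D / (2 * Real.log 8) := by positivity
        exact_mod_cast lt_of_lt_of_le this hkl
      have e3 : 2 * c2 * ((8 : ℝ) ^ k) ^ α ≤ N := by
        calc 2 * c2 * ((8 : ℝ) ^ k) ^ α ≤ 2 * c2 * (δ * D) ^ α := by gcongr
          _ = c1 * D ^ α := by rw [Real.mul_rpow hδ0.le hD.le, ← hδA]; ring
          _ ≤ N := hNl
      have e4 := mean_lower_log H hC2 CS b h k hk0 e3
      have e5 := frost H a b (κ := 0) le_rfl (by norm_num) (by linarith) hc0
        (by rw [G.dist_comm]; exact hab)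
      rw [← hCm] at e4
      rw [← hF, neg_zero, Real.rpow_zero, mul_one] at e5
      rw [← div_le_iff₀ hCm0] at e4
      have e6 : F * N ≤ N * (Real.log D / (4 * Real.log 8 * Cm)) := by
        rw [mul_comm F]
        refine mul_le_mul_of_nonneg_left ?_ hN.le
        rw [le_div_iff₀ (by positivity)]
        linarith
      have e7 : 2 * (N * (Real.log D / (4 * Real.log 8 * Cm))) ≤ k * N / Cm := by
        calc 2 * (N * (Real.log D / (4 * Real.log 8 * Cm)))
            = Real.log D / (2 * Real.log 8) * N / Cm := by field_simp; norm_num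
          _ ≤ _ := by gcongr
      have e8 : N * (Real.log D / (4 * Real.log 8 * Cm)) ≤ hit K a b := by linarith
      refine le_trans ?_ e8
      calc min (c1 / (4 * Real.log 8 * Cm)) (1 / (D1 ^ θ * Real.log D1)) * (D ^ θ * Real.log D)
          ≤ c1 / (4 * Real.log 8 * Cm) * (D ^ θ * Real.log D) := by
            gcongr; exact min_le_left _ _
        _ = c1 * D ^ α * (Real.log D / (4 * Real.log 8 * Cm)) := by rw [h]; ring
        _ ≤ _ := by gcongr
    · refine le_trans ?_ (one_le_hit H (ne_of_far hD hc0 hab))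
      have hθ : 0 ≤ θ := by linarith
      calc min (c1 / (4 * Real.log 8 * Cm)) (1 / (D1 ^ θ * Real.log D1)) * (D ^ θ * Real.log D)
          ≤ 1 / (D1 ^ θ * Real.log D1) * (D1 ^ θ * Real.log D1) := by
            gcongr; exact min_le_right _ _
        _ = 1 := by field_simp
  · obtain ⟨J, hJ1, hJ2⟩ := exists_J (D := D) (by linarith)
    refine (hit_upper H a b J hJ1 hJ2).trans ?_
    unfold Tsum
    have e0 : ∑ i ∈ Finset.range (J + 1), ((2 : ℝ) ^ (θ - α)) ^ i = (J : ℝ) + 1 := by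
      rw [h]; simp
    have e1 : (J : ℝ) + 1 ≤ 3 / Real.log 2 * Real.log D := by
      have h1 := Real.log_le_log (by positivity) hJ2
      rw [Real.log_mul (by norm_num) hD.ne', Real.log_pow] at h1
      have h2 := Real.log_le_log (by norm_num) hD2
      rw [div_mul_eq_mul_div, le_div_iff₀ hl2]
      linarith
    rw [e0]
    calc 2 * (25 * CP * CD / c1 * N * ((J : ℝ) + 1))
        ≤ 2 * (25 * CP * CD / c1 * (c2 * D ^ α) * (3 / Real.log 2 * Real.log D)) := by
          gcongr
      _ = _ := by rw [h]; ring

lemma mkHS {V : Type} [Fintype V] [DecidableEq V] {G : SimpleGraph V} {K : V → V → ℝ} {pi : V → ℝ}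
    {θ α ca1 ca2 p0 CD CP Ccs1 Ccs2 ε : ℝ} (hα : 0 < α) (hca1 : 0 < ca1) (hca2 : 0 < ca2)
    (hM : IsMarkovKernel G K pi) (hH : Harnack G K pi θ p0 CD CP Ccs1 Ccs2 ε) (hD : 2 ≤ gdiam G)
    (hA : ∀ x : V, ∀ r : ℝ, 1 ≤ r → r ≤ (gdiam G : ℝ) →
            ca1 * r ^ α ≤ (Fintype.card V : ℝ) * vol G pi x r ∧
            (Fintype.card V : ℝ) * vol G pi x r ≤ ca2 * r ^ α) (a : V) :
    HS G K pi θ α (ca1 / 2 ^ α) ca2 CD CP (Fintype.card V : ℝ) (gdiam G : ℝ) := by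
  obtain ⟨m1, m2, m3, m4, m5, m6, m7, m8, m9⟩ := hM
  obtain ⟨k1, k2, k3, k4, k5, k6, k7, k8, k9, k10⟩ := hH
  have hD2 : (2 : ℝ) ≤ gdiam G := by exact_mod_cast hD
  have hdist : ∀ x y, (G.dist x y : ℝ) ≤ gdiam G := by
    intro x y
    have h1 : G.dist x y ≤ univ.sup fun y => G.dist x y :=
      Finset.le_sup (f := fun y => G.dist x y) (mem_univ y)
    have h2 : (univ.sup fun y => G.dist x y) ≤ gdiam G :=
      Finset.le_sup (f := fun x => univ.sup fun y => G.dist x y) (mem_univ x)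
    exact_mod_cast h1.trans h2
  have hv : ∀ x r, (gdiam G : ℝ) ≤ r → vol G pi x r = vol G pi x (gdiam G : ℝ) := by
    intro x r hr
    have : ∀ s : ℝ, (gdiam G : ℝ) ≤ s → gball G x s = univ := by
      intro s hs
      ext y
      simp only [gball, mem_filter, mem_univ, true_and, iff_true]
      exact (hdist x y).trans hs
    unfold vol
    rw [this r hr, this _ le_rfl]
  have hc : 0 < (Fintype.card V : ℝ) := by
    exact_mod_cast Fintype.card_pos_iff.2 ⟨a⟩
  refine ⟨m1, m2, m3, m4, m5, m6, m8, ⟨p0, k1, k7⟩, k8, k9, by positivity, hca2, k2, k3, hc, hD2,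
    hdist, ?_, ?_⟩
  · intro x r h1 h2
    have hr : ca1 / 2 ^ α * r ^ α = ca1 * (r / 2) ^ α := by
      rw [Real.div_rpow (by linarith) (by norm_num)]; ring
    rw [hr]
    rcases le_total r (gdiam G : ℝ) with h | h
    · refine le_trans ?_ (hA x r h1 h).1
      gcongr
      linarith
    · rw [hv x r h]
      refine le_trans ?_ (hA x _ (by linarith) le_rfl).1
      gcongr
      linarith
  · intro x r h1
    rcases le_total r (gdiam G : ℝ) with h | h
    · exact (hA x r h1 h).2
    · rw [hv x r h]
      refine (hA x _ (by linarith) le_rfl).2.trans ?_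
      gcongr

end cases

/-- On an Ahlfors-regular Harnack graph (`|V|·V(x,r) ≍ r^α` for
`1 ≤ r ≤ D`), for `a,b` with `d(a,b) ≥ c₀D`: `H(a,b) ≍ D^α` if `α > θ`,
`H(a,b) ≍ D^θ log D` if `α = θ`, and `H(a,b) ≍ D^θ` if `0 < α < θ`. -/
theorem stmt14 (θ α c0 ca1 ca2 p0 CD CP Ccs1 Ccs2 ε : ℝ)
    (hθ : 2 ≤ θ) (hα : 0 < α) (hc0 : 0 < c0) (hca1 : 0 < ca1) (hca2 : 0 < ca2) :
    ∃ c > (0 : ℝ), ∃ C > (0 : ℝ),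
      ∀ (V : Type) [Fintype V] [DecidableEq V],
        ∀ (G : SimpleGraph V) (K : V → V → ℝ) (pi : V → ℝ),
          IsMarkovKernel G K pi → Harnack G K pi θ p0 CD CP Ccs1 Ccs2 ε →
          2 ≤ gdiam G →
          (∀ x : V, ∀ r : ℝ, 1 ≤ r → r ≤ (gdiam G : ℝ) →
            ca1 * r ^ α ≤ (Fintype.card V : ℝ) * vol G pi x r ∧
            (Fintype.card V : ℝ) * vol G pi x r ≤ ca2 * r ^ α) →
          ∀ a b : V, c0 * (gdiam G : ℝ) ≤ (G.dist a b : ℝ) →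
            ((θ < α →
                c * (gdiam G : ℝ) ^ α ≤ hit K a b ∧
                hit K a b ≤ C * (gdiam G : ℝ) ^ α) ∧
             (α = θ →
                c * ((gdiam G : ℝ) ^ θ * Real.log (gdiam G)) ≤ hit K a b ∧
                hit K a b ≤ C * ((gdiam G : ℝ) ^ θ * Real.log (gdiam G))) ∧
             (α < θ →
                c * (gdiam G : ℝ) ^ θ ≤ hit K a b ∧
                hit K a b ≤ C * (gdiam G : ℝ) ^ θ)) := by
  by_cases hpos : 0 < CD ∧ 0 < CP ∧ 0 < Ccs2
  swap
  · refine ⟨1, one_pos, 1, one_pos, ?_⟩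
    intro V _ _ G K pi _ hH
    exact absurd ⟨hH.2.1, hH.2.2.1, hH.2.2.2.2.1⟩ hpos
  obtain ⟨hCD, hCP, hC2⟩ := hpos
  have hc1 : 0 < ca1 / 2 ^ α := by positivity
  rcases lt_trichotomy α θ with h | h | h
  · obtain ⟨c, hc, C, hC, hmain⟩ := case_lt θ α c0 (ca1 / 2 ^ α) ca2 CD CP Ccs1 Ccs2 ε hα h hc0
      hc1 hca2 hCD hCP hC2
    refine ⟨c, hc, C, hC, ?_⟩
    intro V _ _ G K pi hM hH hD hA a b hab
    have := hmain V G K pi _ _ (mkHS hα hca1 hca2 hM hH hD hA a) hH.2.2.2.2.2.2.2.2.2 a b hab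
    exact ⟨fun h' => absurd h' (by linarith), fun h' => absurd h' h.ne, fun _ => this⟩
  · obtain ⟨c, hc, C, hC, hmain⟩ := case_eq θ α c0 (ca1 / 2 ^ α) ca2 CD CP Ccs1 Ccs2 ε hα h hc0
      hc1 hca2 hCD hCP hC2
    refine ⟨c, hc, C, hC, ?_⟩
    intro V _ _ G K pi hM hH hD hA a b hab
    have := hmain V G K pi _ _ (mkHS hα hca1 hca2 hM hH hD hA a) hH.2.2.2.2.2.2.2.2.2 a b hab
    exact ⟨fun h' => absurd h' (by linarith), fun _ => this, fun h' => absurd h' (by linarith)⟩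
  · obtain ⟨c, hc, C, hC, hmain⟩ := case_gt θ α c0 (ca1 / 2 ^ α) ca2 CD CP Ccs1 Ccs2 ε hα h hc0
      hc1 hca2 hCD hCP hC2
    refine ⟨c, hc, C, hC, ?_⟩
    intro V _ _ G K pi hM hH hD hA a b hab
    have := hmain V G K pi _ _ (mkHS hα hca1 hca2 hM hH hD hA a) hH.2.2.2.2.2.2.2.2.2 a b hab
    exact ⟨fun _ => this, fun h' => absurd h' h.ne', fun h' => absurd h' (by linarith)⟩
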